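/- arXiv:1601.04344 — 7 statements merged into one kernel-verified Lean document; each statement's English description precedes it below -/
import Mathlib

section
/- Let (X, d_X) be a Polish space and let ℝⁿ act on X by maps θ_y that are continuous in y and continuous in u uniformly with respect to y in compact subsets of ℝⁿ. If f : X × ℝⁿ → [0,∞] is lower semicontinuous, then the map y ↦ θ_y f is continuous with respect to Γ-convergence; that is, for every sequence y_n → y in ℝⁿ, the translated integrands θ_{y_n} f Γ-converge to θ_y f. -/
open Filter Topology MeasureTheory Metric ENNReal

noncomputable section

/-- Euclidean space `ℝⁿ`. -/
abbrev Rn (n : ℕ) : Type := EuclideanSpace ℝ (Fin n)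

/-- Sequential Γ-convergence of a sequence of integrands `F k : X × ℝⁿ → [0,∞]`
to an integrand `f`, with respect to the couple `(u,y)`. -/
def GammaConv {X : Type*} [MetricSpace X] {n : ℕ}
    (F : ℕ → X × Rn n → ℝ≥0∞) (f : X × Rn n → ℝ≥0∞) : Prop :=
  (∀ (p : ℕ → X × Rn n) (q : X × Rn n), Tendsto p atTop (𝓝 q) →
      f q ≤ atTop.liminf fun k => F k (p k)) ∧
  ∀ q : X × Rn n, ∃ p : ℕ → X × Rn n, Tendsto p atTop (𝓝 q) ∧
      atTop.limsup (fun k => F k (p k)) ≤ f q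

/-- The action of `ℝⁿ` on integrands: `θ_y f (u,z) = f (θ_{-y} u, z + y)`. -/
def actInt {X : Type*} [MetricSpace X] {n : ℕ} (θ : Rn n → X → X)
    (y : Rn n) (f : X × Rn n → ℝ≥0∞) : X × Rn n → ℝ≥0∞ :=
  fun p => f (θ (-y) p.1, p.2 + y)

/-- An action of `ℝⁿ` that is continuous in `y`, and continuous in `u` uniformly for `y` in
compact sets, is jointly continuous. -/
theorem continuous_action_prod {X : Type*} [MetricSpace X] {n : ℕ} {θ : Rn n → X → X}
    (hy : ∀ u : X, Continuous fun y => θ y u)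
    (hu : ∀ K : Set (Rn n), IsCompact K → ∀ u : X, ∀ ε > 0, ∃ δ > 0,
      ∀ v : X, dist v u < δ → ∀ y ∈ K, dist (θ y v) (θ y u) < ε) :
    Continuous fun p : Rn n × X => θ p.1 p.2 := by
  refine continuous_iff_continuousAt.2 fun ⟨a, u⟩ => Metric.tendsto_nhds.2 fun ε hε => ?_
  obtain ⟨δ, hδ, h⟩ := hu (closedBall a 1) (isCompact_closedBall a 1) u (ε / 2) (half_pos hε)
  have hfst : ∀ᶠ p : Rn n × X in 𝓝 (a, u), p.1 ∈ closedBall a 1 :=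
    continuous_fst.continuousAt.eventually_mem (closedBall_mem_nhds a one_pos)
  have hsnd : ∀ᶠ p : Rn n × X in 𝓝 (a, u), p.2 ∈ ball u δ :=
    continuous_snd.continuousAt.eventually_mem (ball_mem_nhds u hδ)
  have hdist : ∀ᶠ p : Rn n × X in 𝓝 (a, u), θ p.1 u ∈ ball (θ a u) (ε / 2) :=
    ((hy u).comp continuous_fst).continuousAt.eventually_mem (ball_mem_nhds _ (half_pos hε))
  filter_upwards [hfst, hsnd, hdist] with p h₁ h₂ h₃
  calc dist (θ p.1 p.2) (θ a u) ≤ dist (θ p.1 p.2) (θ p.1 u) + dist (θ p.1 u) (θ a u) :=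
        dist_triangle _ _ _
    _ < ε / 2 + ε / 2 := add_lt_add (h p.2 h₂ p.1 h₁) h₃
    _ = ε := add_halves ε

/-- A lower semicontinuous function is sequentially lower semicontinuous. -/
theorem LowerSemicontinuousAt.le_liminf_of_tendsto {α ι β : Type*} [TopologicalSpace α]
    [CompleteLinearOrder β] [DenselyOrdered β] {l : Filter ι} {f : α → β} {x : α}
    (hf : LowerSemicontinuousAt f x) {p : ι → α} (hp : Tendsto p l (𝓝 x)) :
    f x ≤ liminf (fun k => f (p k)) l :=
  le_of_forall_lt_imp_le_of_dense fun b hb =>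
    le_liminf_of_le (by isBoundedDefault) ((hp.eventually (hf b hb)).mono fun _ h => h.le)

/-- If `f` is a lower semicontinuous integrand, then `y ↦ θ_y f` is continuous for the
topology of Γ-convergence: whenever `y_k → y`, the integrands `θ_{y_k} f` Γ-converge
to `θ_y f`. -/
theorem translation_gamma_continuous
    {X : Type*} [MetricSpace X] {n : ℕ}
    -- completeness and separability of the Polish space X
    [CompleteSpace X] [TopologicalSpace.SeparableSpace X]
    (θ : Rn n → X → X)
    -- θ is an action of ℝⁿ on X
    (hθ_zero : ∀ u : X, θ 0 u = u)
    (hθ_add : ∀ (y z : Rn n) (u : X), θ (y + z) u = θ y (θ z u))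
    -- the action is continuous in y
    (hθ_cont_y : ∀ u : X, Continuous fun y => θ y u)
    -- the action is continuous in u, uniformly with respect to y in compact sets
    (hθ_cont_u : ∀ K : Set (Rn n), IsCompact K → ∀ u : X, ∀ ε > 0, ∃ δ > 0,
      ∀ v : X, dist v u < δ → ∀ y ∈ K, dist (θ y v) (θ y u) < ε)
    (f : X × Rn n → ℝ≥0∞) (hf : LowerSemicontinuous f)
    (y : ℕ → Rn n) (ylim : Rn n) (hy : Tendsto y atTop (𝓝 ylim)) :
    GammaConv (fun k => actInt θ (y k) f) (actInt θ ylim f) := by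
  have hθ := continuous_action_prod hθ_cont_y hθ_cont_u
  refine ⟨fun p q hp => ?_, fun q => ?_⟩
  · refine LowerSemicontinuousAt.le_liminf_of_tendsto (hf _)
      (p := fun k => (θ (-y k) (p k).1, (p k).2 + y k)) ?_
    have hfst := (continuous_fst.tendsto q).comp hp
    have hsnd := (continuous_snd.tendsto q).comp hp
    exact ((hθ.tendsto (-ylim, q.1)).comp (hy.neg.prodMk_nhds hfst)).prodMk_nhds (hsnd.add hy)
  · refine ⟨fun k => (θ (y k) (θ (-ylim) q.1), q.2 + ylim - y k), ?_, ?_⟩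
    · have hfst : Tendsto (fun k => θ (y k) (θ (-ylim) q.1)) atTop (𝓝 q.1) := by
        simpa [Function.comp_def, ← hθ_add, hθ_zero] using
          ((hθ_cont_y (θ (-ylim) q.1)).tendsto ylim).comp hy
      have hsnd : Tendsto (fun k => q.2 + ylim - y k) atTop (𝓝 q.2) := by
        simpa using (tendsto_const_nhds (x := q.2 + ylim)).sub hy
      exact hfst.prodMk_nhds hsnd
    · simp [actInt, ← hθ_add]
end
end

section
/- Let F be a family of lower semicontinuous integrands on X × ℝⁿ that are all bounded below by a fixed coercive lower semicontinuous integrand f_0, and assume F has property (M). If a sequence {f_n} in F Γ-converges to an integrand f, then for every λ > 0 and every (u,y) ∈ X × ℝⁿ, the Yosida regularizations converge pointwise: R_λ f_n(u,y) → R_λ f(u,y). -/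
open Filter Topology MeasureTheory Metric ENNReal

noncomputable section

/-- The Yosida regularization of an integrand `f` with parameter `λ`:
`R_λ f (u,y) = inf_{(v,z)} [ f(v,z) + λ (d_X(u,v) + |y-z|) ]`. -/
def yosida {X : Type*} [MetricSpace X] {n : ℕ}
    (f : X × Rn n → ℝ≥0∞) (lam : ℝ) (u : X) (y : Rn n) : ℝ≥0∞ :=
  ⨅ p : X × Rn n, f p + ENNReal.ofReal (lam * (dist u p.1 + dist y p.2))

/-- The Yosida infimum restricted to a subset `K` of `X × ℝⁿ`. -/
def yosidaOn {X : Type*} [MetricSpace X] {n : ℕ}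
    (f : X × Rn n → ℝ≥0∞) (lam : ℝ) (u : X) (y : Rn n) (K : Set (X × Rn n)) : ℝ≥0∞ :=
  ⨅ p ∈ K, f p + ENNReal.ofReal (lam * (dist u p.1 + dist y p.2))

/-- The average of `y ↦ f(u,y)` over the ball `B(0,R)` in `ℝⁿ`. -/
def avgBall {X : Type*} [MetricSpace X] {n : ℕ}
    (f : X × Rn n → ℝ≥0∞) (u : X) (R : ℝ) : ℝ≥0∞ :=
  (∫⁻ y in ball (0 : Rn n) R, f (u, y)) / volume (ball (0 : Rn n) R)

/-- An integrand `f₀` is coercive if for every positive function `C` on `(0,∞)`,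
the set of `u ∈ X` whose averages of `f₀(u,·)` over all balls `B(0,R)` are bounded
by `C(R)` is compact in `X`. -/
def Coercive {X : Type*} [MetricSpace X] {n : ℕ} (f₀ : X × Rn n → ℝ≥0∞) : Prop :=
  ∀ C : ℝ → ℝ, (∀ R > 0, 0 < C R) →
    IsCompact {u : X | ∀ R > 0, avgBall f₀ u R ≤ ENNReal.ofReal (C R)}

/-- Property (M) for a family of integrands: there are a coercive lower semicontinuous
integrand `f₀` bounding the family from below, and compact sets `K_{M,u,y,λ}` such that
whenever `R_λ f (u,y) < M` the infimum defining `R_λ f (u,y)` may be restricted to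
`K_{M,u,y,λ}`. -/
def PropertyM {X : Type*} [MetricSpace X] {n : ℕ}
    (Fam : Set (X × Rn n → ℝ≥0∞)) : Prop :=
  ∃ f₀ : X × Rn n → ℝ≥0∞, LowerSemicontinuous f₀ ∧ Coercive f₀ ∧
    ∃ K : ℝ → X → Rn n → ℝ → Set (X × Rn n),
      (∀ M u y lam, IsCompact (K M u y lam)) ∧
      ∀ f ∈ Fam, (∀ p, f₀ p ≤ f p) ∧
        ∀ (M : ℝ) (u : X) (y : Rn n) (lam : ℝ), 0 < lam →
          yosida f lam u y < ENNReal.ofReal M →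
          yosida f lam u y = yosidaOn f lam u y (K M u y lam)

theorem tendsto_yosidaCost {X : Type*} [MetricSpace X] {n : ℕ} (lam : ℝ) (u : X) (y : Rn n)
    {ι : Type*} {l : Filter ι} {p : ι → X × Rn n} {q : X × Rn n} (hp : Tendsto p l (𝓝 q)) :
    Tendsto (fun i => ENNReal.ofReal (lam * (dist u (p i).1 + dist y (p i).2))) l
      (𝓝 (ENNReal.ofReal (lam * (dist u q.1 + dist y q.2)))) := by
  have hcont : Continuous fun p : X × Rn n =>
      ENNReal.ofReal (lam * (dist u p.1 + dist y p.2)) :=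
    ENNReal.continuous_ofReal.comp (by fun_prop)
  exact (hcont.tendsto q).comp hp

/-- A sequence converging along a subsequence extends to a convergent sequence. -/
theorem exists_tendsto_extension {Y : Type*} [TopologicalSpace Y] {χ : ℕ → ℕ}
    (hχ : StrictMono χ) {p : ℕ → Y} {q : Y} (hp : Tendsto (p ∘ χ) atTop (𝓝 q)) :
    ∃ p' : ℕ → Y, Tendsto p' atTop (𝓝 q) ∧ ∀ j, p' (χ j) = p (χ j) := by
  classical
  refine ⟨fun k => if k ∈ Set.range χ then p k else q, ?_, fun j => if_pos ⟨j, rfl⟩⟩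
  intro U hU
  obtain ⟨N, hN⟩ := eventually_atTop.1 (hp hU)
  refine mem_map.2 (mem_atTop_sets.2 ⟨χ N, fun k hk => ?_⟩)
  by_cases hkχ : k ∈ Set.range χ
  · obtain ⟨j, rfl⟩ := hkχ
    simpa using hN j (hχ.le_iff_le.1 hk)
  · simpa only [Set.mem_preimage, if_neg hkχ] using mem_of_mem_nhds hU

/-- The upper bound: a recovery sequence makes the Yosida regularizations eventually smaller than
any number above that of the Γ-limit. -/
theorem GammaConv.eventually_yosida_lt {X : Type*} [MetricSpace X] {n : ℕ}
    {F : ℕ → X × Rn n → ℝ≥0∞} {f : X × Rn n → ℝ≥0∞} (hconv : GammaConv F f)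
    {lam : ℝ} {u : X} {y : Rn n} {a : ℝ≥0∞} (ha : yosida f lam u y < a) :
    ∀ᶠ k in atTop, yosida (F k) lam u y < a := by
  obtain ⟨q, hq⟩ := iInf_lt_iff.1 ha
  obtain ⟨p, hp, hlim⟩ := hconv.2 q
  obtain ⟨d, hd, hda⟩ := exists_between (lt_tsub_iff_right.2 hq)
  have hcost := (tendsto_yosidaCost lam u y hp).const_add d
  filter_upwards [eventually_lt_of_limsup_lt (hlim.trans_lt hd),
    hcost.eventually_lt_const (lt_tsub_iff_right.1 hda)] with k hk hka
  exact (iInf_le _ (p k)).trans_lt ((add_le_add_left hk.le _).trans_lt hka)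

/-- The lower bound: if values of the Yosida functionals at most `b` are frequently attained in a
compact set, then the Yosida regularization of the Γ-limit is at most `b`. -/
theorem GammaConv.yosida_le_of_frequently {X : Type*} [MetricSpace X] {n : ℕ}
    {F : ℕ → X × Rn n → ℝ≥0∞} {f : X × Rn n → ℝ≥0∞} (hconv : GammaConv F f)
    {lam : ℝ} {u : X} {y : Rn n} {K : Set (X × Rn n)} (hK : IsCompact K) {b : ℝ≥0∞}
    (hfreq : ∃ᶠ k in atTop, ∃ p ∈ K,
      F k p + ENNReal.ofReal (lam * (dist u p.1 + dist y p.2)) ≤ b) :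
    yosida f lam u y ≤ b := by
  obtain ⟨φ, hφ, hφb⟩ := extraction_of_frequently_atTop hfreq
  choose r hrK hrb using hφb
  obtain ⟨q, -, ψ, hψ, hrq⟩ := hK.tendsto_subseq hrK
  have hinv : ∀ j, r (Function.invFun φ (φ j)) = r j := fun j => by
    rw [Function.leftInverse_invFun hφ.injective j]
  obtain ⟨p, hp, hpr⟩ := exists_tendsto_extension (p := r ∘ Function.invFun φ) (hφ.comp hψ)
    (q := q) (hrq.congr fun j => (hinv (ψ j)).symm)
  have hχ : Tendsto (φ ∘ ψ) atTop atTop := (hφ.comp hψ).tendsto_atTop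
  refine (iInf_le _ q).trans ?_
  suffices h : f q ≤ b - ENNReal.ofReal (lam * (dist u q.1 + dist y q.2)) by
    have hqb : ENNReal.ofReal (lam * (dist u q.1 + dist y q.2)) ≤ b :=
      le_of_tendsto' (tendsto_yosidaCost lam u y hrq) fun j => le_add_self.trans (hrb (ψ j))
    exact (add_le_add_left h _).trans (tsub_add_cancel_of_le hqb).le
  refine le_of_forall_lt_imp_le_of_dense fun c hc => ?_
  refine ENNReal.le_sub_of_add_le_right ENNReal.ofReal_ne_top ?_
  refine le_of_tendsto ((tendsto_yosidaCost lam u y hrq).const_add c) ?_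
  filter_upwards [hχ.eventually (eventually_lt_of_lt_liminf (hc.trans_le (hconv.1 p q hp)))]
    with j hj
  have hpj : p (φ (ψ j)) = r (ψ j) := (hpr j).trans (hinv (ψ j))
  simp only [Function.comp_apply, hpj] at hj
  exact (add_le_add_left hj.le _).trans (hrb (ψ j))

/-- If a family `Fam` of lower semicontinuous integrands is bounded below by a fixed
coercive lower semicontinuous integrand `f₀` and has property (M), and if a sequence
`F k` in `Fam` Γ-converges to `f`, then the Yosida regularizations converge pointwise:
`R_λ (F k) (u,y) → R_λ f (u,y)` for every `λ > 0` and every `(u,y)`. -/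
theorem yosida_converges_of_gammaConv
    {X : Type*} [MetricSpace X] [CompleteSpace X] [TopologicalSpace.SeparableSpace X] {n : ℕ}
    (Fam : Set (X × Rn n → ℝ≥0∞))
    (hFamLsc : ∀ f ∈ Fam, LowerSemicontinuous f)
    (f₀ : X × Rn n → ℝ≥0∞) (hf₀lsc : LowerSemicontinuous f₀) (hf₀coer : Coercive f₀)
    (hbelow : ∀ f ∈ Fam, ∀ p, f₀ p ≤ f p)
    (hM : PropertyM Fam)
    (F : ℕ → X × Rn n → ℝ≥0∞) (hF : ∀ k, F k ∈ Fam)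
    (f : X × Rn n → ℝ≥0∞) (hconv : GammaConv F f)
    (lam : ℝ) (hlam : 0 < lam) (u : X) (y : Rn n) :
    Tendsto (fun k => yosida (F k) lam u y) atTop (𝓝 (yosida f lam u y)) := by
  obtain ⟨_, -, -, K, hK, hKM⟩ := hM
  refine tendsto_order.2 ⟨fun a ha => ?_, fun a ha => hconv.eventually_yosida_lt ha⟩
  obtain ⟨b, hab, hb⟩ := exists_between ha
  by_contra hcon
  refine hb.not_ge (hconv.yosida_le_of_frequently (hK b.toReal u y lam) ?_)
  refine (not_eventually.1 hcon).mono fun k hk => ?_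
  have hkb : yosida (F k) lam u y < b := (not_lt.1 hk).trans_lt hab
  have hres := (hKM (F k) (hF k)).2 b.toReal u y lam hlam
    (by rwa [ENNReal.ofReal_toReal hb.ne_top])
  rw [hres] at hkb
  obtain ⟨p, hp⟩ := iInf_lt_iff.1 hkb
  obtain ⟨hpK, hpb⟩ := iInf_lt_iff.1 hp
  exact ⟨p, hpK, hpb.le⟩
end
end

section
/- Let F be a family of lower semicontinuous integrands on X × ℝⁿ bounded below by a fixed coercive lower semicontinuous integrand f_0 and having property (M). If {f_n} is a sequence in F and f is a lower semicontinuous integrand such that R_λ f_n(u,y) → R_λ f(u,y) for every positive integer λ and every (u,y) ∈ X × ℝⁿ, then {f_n} Γ-converges to f. -/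
open Filter Topology MeasureTheory Metric ENNReal

noncomputable section

/-- The Yosida regularizations of a lower semicontinuous integrand increase to it: every value
strictly below `f q` is eventually reached by some `R_λ f (q)` with `λ` a positive integer. -/
theorem exists_nat_le_yosida {X : Type*} [MetricSpace X] {n : ℕ} {f : X × Rn n → ℝ≥0∞}
    (hf : LowerSemicontinuous f) {q : X × Rn n} {c : ℝ≥0∞} (hc : c < f q) :
    ∃ lam : ℕ, 1 ≤ lam ∧ c ≤ yosida f (lam : ℝ) q.1 q.2 := by
  obtain ⟨δ, hδ, hball⟩ := Metric.eventually_nhds_iff.1 (hf q c hc)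
  obtain ⟨m, hm⟩ := exists_nat_ge (c.toReal / δ)
  refine ⟨m + 1, by omega, le_iInf fun p => ?_⟩
  by_cases hp : dist p q < δ
  · exact (hball hp).le.trans le_self_add
  · have hd : δ ≤ dist q.1 p.1 + dist q.2 p.2 := by
      refine (not_lt.1 hp).trans ?_
      rw [dist_comm, Prod.dist_eq]
      exact max_le_add_of_nonneg dist_nonneg dist_nonneg
    have hcm : c.toReal ≤ ((m + 1 : ℕ) : ℝ) * (dist q.1 p.1 + dist q.2 p.2) := by
      rw [div_le_iff₀ hδ] at hm
      push_cast
      nlinarith [mul_le_mul_of_nonneg_left hd (Nat.cast_nonneg (α := ℝ) m)]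
    calc c = ENNReal.ofReal c.toReal := (ENNReal.ofReal_toReal hc.ne_top).symm
      _ ≤ _ := ENNReal.ofReal_le_ofReal hcm
      _ ≤ _ := le_add_self

/-- The limit of the Yosida regularizations at `q` bounds from below the values of the integrands
along any sequence converging to `q`. -/
theorem le_liminf_of_tendsto_yosida {X : Type*} [MetricSpace X] {n : ℕ}
    {F : ℕ → X × Rn n → ℝ≥0∞} {lam : ℝ} {p : ℕ → X × Rn n} {q : X × Rn n} {L : ℝ≥0∞}
    (hL : Tendsto (fun k => yosida (F k) lam q.1 q.2) atTop (𝓝 L))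
    (hp : Tendsto p atTop (𝓝 q)) : L ≤ atTop.liminf fun k => F k (p k) := by
  have he : Tendsto (fun k => ENNReal.ofReal (lam * (dist q.1 (p k).1 + dist q.2 (p k).2)))
      atTop (𝓝 0) := by
    have hcont : Continuous fun r : X × Rn n =>
        ENNReal.ofReal (lam * (dist q.1 r.1 + dist q.2 r.2)) :=
      ENNReal.continuous_ofReal.comp (by fun_prop)
    simpa [Function.comp_def] using (hcont.tendsto q).comp hp
  have hsub := ENNReal.Tendsto.sub hL he (Or.inr zero_ne_top)
  rw [tsub_zero] at hsub
  rw [← hsub.liminf_eq]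
  exact liminf_le_liminf (Eventually.of_forall fun k => tsub_le_iff_right.2 (iInf_le _ (p k)))

/-- A bound on the Yosida regularization at `q` yields a nearby point with almost no larger
value. -/
theorem exists_dist_le_of_yosida_lt {X : Type*} [MetricSpace X] {n : ℕ} {g : X × Rn n → ℝ≥0∞}
    {lam : ℝ} (hlam : 0 < lam) {q : X × Rn n} {a : ℝ≥0∞} (ha : a ≠ ⊤)
    (h : yosida g lam q.1 q.2 < a) : ∃ p, dist p q ≤ a.toReal / lam ∧ g p ≤ a := by
  obtain ⟨p, hp⟩ := iInf_lt_iff.1 h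
  refine ⟨p, ?_, le_self_add.trans hp.le⟩
  have hle : lam * (dist q.1 p.1 + dist q.2 p.2) ≤ a.toReal :=
    (ENNReal.ofReal_le_iff_le_toReal ha).1 (le_add_self.trans hp.le)
  rw [le_div_iff₀ hlam, mul_comm]
  refine le_trans (mul_le_mul_of_nonneg_left ?_ hlam.le) hle
  rw [dist_comm, Prod.dist_eq]
  exact max_le_add_of_nonneg dist_nonneg dist_nonneg

/-- Diagonal selection: if each of countably many conditions, decreasing in `m`, can eventually
be met, then one sequence eventually meets all of them. -/
theorem exists_seq_forall_eventually {α : Type*} [Nonempty α] {P : ℕ → ℕ → α → Prop}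
    (hanti : ∀ m m' k a, m ≤ m' → P m' k a → P m k a)
    (hP : ∀ m, ∀ᶠ k in atTop, ∃ a, P m k a) :
    ∃ p : ℕ → α, ∀ m, ∀ᶠ k in atTop, P m k (p k) := by
  classical
  refine ⟨fun k => Classical.epsilon
    (P (Nat.findGreatest (fun m => ∃ a, P m k a) k) k), fun m => ?_⟩
  filter_upwards [hP m, eventually_ge_atTop m] with k hk hmk
  exact hanti _ _ _ _ (Nat.le_findGreatest hmk hk)
    (Classical.epsilon_spec (Nat.findGreatest_spec (P := fun m => ∃ a, P m k a) hmk hk))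

/-- If a family `Fam` of lower semicontinuous integrands is bounded below by a fixed
coercive lower semicontinuous integrand `f₀` and has property (M), and if `F k` is a
sequence in `Fam` whose Yosida regularizations `R_λ (F k)` converge pointwise to
`R_λ f` for every positive integer `λ`, where `f` is a lower semicontinuous integrand,
then `F k` Γ-converges to `f`. -/
theorem gammaConv_of_yosida_converges
    {X : Type*} [MetricSpace X] [CompleteSpace X] [TopologicalSpace.SeparableSpace X] {n : ℕ}
    (Fam : Set (X × Rn n → ℝ≥0∞))
    (hFamLsc : ∀ f ∈ Fam, LowerSemicontinuous f)
    (f₀ : X × Rn n → ℝ≥0∞) (hf₀lsc : LowerSemicontinuous f₀) (hf₀coer : Coercive f₀)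
    (hbelow : ∀ f ∈ Fam, ∀ p, f₀ p ≤ f p)
    (hM : PropertyM Fam)
    (F : ℕ → X × Rn n → ℝ≥0∞) (hF : ∀ k, F k ∈ Fam)
    (f : X × Rn n → ℝ≥0∞) (hflsc : LowerSemicontinuous f)
    (hyos : ∀ lam : ℕ, 1 ≤ lam → ∀ (u : X) (y : Rn n),
      Tendsto (fun k => yosida (F k) (lam : ℝ) u y) atTop (𝓝 (yosida f (lam : ℝ) u y))) :
    GammaConv F f := by
  refine ⟨fun p q hp => le_of_forall_lt_imp_le_of_dense fun c hc => ?_, fun q => ?_⟩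
  · obtain ⟨lam, hlam, hle⟩ := exists_nat_le_yosida hflsc hc
    exact hle.trans (le_liminf_of_tendsto_yosida (hyos lam hlam q.1 q.2) hp)
  rcases eq_or_ne (f q) ⊤ with htop | htop
  · exact ⟨fun _ => q, tendsto_const_nhds, htop ▸ le_top⟩
  have hpos (m : ℕ) : (0 : ℝ) < 1 / ((m : ℝ) + 1) := Nat.one_div_pos_of_nat
  have : Nonempty (X × Rn n) := ⟨q⟩
  obtain ⟨p, hp⟩ := exists_seq_forall_eventually (α := X × Rn n)
    (P := fun m k p => dist p q ≤ 1 / ((m : ℝ) + 1) ∧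
      F k p ≤ f q + ENNReal.ofReal (1 / ((m : ℝ) + 1)))
    (fun m m' k a hmm h => by
      have hle : 1 / ((m' : ℝ) + 1) ≤ 1 / ((m : ℝ) + 1) := Nat.one_div_le_one_div hmm
      exact ⟨h.1.trans hle, h.2.trans (by gcongr)⟩)
    (fun m => by
      set a := f q + ENNReal.ofReal (1 / ((m : ℝ) + 1)) with ha
      have hatop : a ≠ ⊤ := ENNReal.add_ne_top.2 ⟨htop, ENNReal.ofReal_ne_top⟩
      have hlt : f q < a := ENNReal.lt_add_right htop (by simpa using hpos m)
      obtain ⟨N, hN⟩ := exists_nat_ge (a.toReal / (1 / ((m : ℝ) + 1)))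
      have hN0 : (0 : ℝ) < (N + 1 : ℕ) := by positivity
      have hyle : yosida f ((N + 1 : ℕ) : ℝ) q.1 q.2 ≤ f q :=
        (iInf_le _ q).trans (by simp)
      filter_upwards [(hyos (N + 1) (by omega) q.1 q.2).eventually_lt_const
        (hyle.trans_lt hlt)] with k hk
      obtain ⟨r, hr, hFr⟩ := exists_dist_le_of_yosida_lt hN0 hatop hk
      refine ⟨r, hr.trans ?_, hFr⟩
      rw [div_le_iff₀ (hpos m)] at hN
      rw [div_le_iff₀ hN0]
      push_cast
      nlinarith [hpos m])
  refine ⟨p, ?_, ?_⟩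
  · rw [Metric.tendsto_nhds]
    intro ε hε
    obtain ⟨m, hm⟩ := exists_nat_one_div_lt hε
    filter_upwards [hp m] with k hk using hk.1.trans_lt hm
  · refine ENNReal.le_of_forall_pos_le_add fun ε hε _ => ?_
    obtain ⟨m, hm⟩ := exists_nat_one_div_lt (NNReal.coe_pos.2 hε)
    refine limsup_le_of_le (by isBoundedDefault) ?_
    filter_upwards [hp m] with k hk
    refine hk.2.trans ?_
    gcongr
    exact ENNReal.ofReal_le_of_le_toReal hm.le
end
end

section
/- Let F be a family of lower semicontinuous integrands on X × ℝⁿ, all bounded below by a fixed coercive lower semicontinuous integrand f_0, and having property (M). Fix a dense sequence (u_k,y_k) in X × ℝⁿ and define for f,g ∈ F the quantity d(f,g) = Σ_{λ,k ≥ 1} 2^{−λ−k} | R_λ f(u_k,y_k)/(1+R_λ f(u_k,y_k)) − R_λ g(u_k,y_k)/(1+R_λ g(u_k,y_k)) |. Then d is a distance on F which metrizes Γ-convergence on F (for sequences f_n, f in F, d(f_n,f) → 0 if and only if f_n Γ-converges to f), and every sequence in F has a subsequence which Γ-converges to some lower semicontinuous integrand; in particular if F is closed under Γ-convergence, then (F,d)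 is a compact metric space. -/
open Filter Topology MeasureTheory Metric ENNReal

noncomputable section

/-- The bounded reparametrization `t ↦ t/(1+t)` of `[0,∞]`, with value `1` at `∞`. -/
def sqz (x : ℝ≥0∞) : ℝ := if x = ∞ then 1 else x.toReal / (1 + x.toReal)

/-- The Dal Maso distance between two integrands, relative to a dense sequence `pts` of
points of `X × ℝⁿ`:
`d(f,g) = Σ_{λ,k ≥ 1} 2^{-λ-k} | R_λf(u_k,y_k)/(1+R_λf(u_k,y_k)) - R_λg(u_k,y_k)/(1+R_λg(u_k,y_k)) |`
(indices shifted so that `λ = l+1`, `k`-th point `pts k`). -/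
def dGamma {X : Type*} [MetricSpace X] {n : ℕ} (pts : ℕ → X × Rn n)
    (f g : X × Rn n → ℝ≥0∞) : ℝ :=
  ∑' lk : ℕ × ℕ, (2 : ℝ) ^ (-(lk.1 : ℤ) - (lk.2 : ℤ) - 2) *
    |sqz (yosida f ((lk.1 : ℝ) + 1) (pts lk.2).1 (pts lk.2).2) -
      sqz (yosida g ((lk.1 : ℝ) + 1) (pts lk.2).1 (pts lk.2).2)|

section Squeeze

lemma sqz_eq_one_sub (x : ℝ≥0∞) : sqz x = 1 - ((1 + x)⁻¹).toReal := by
  unfold sqz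
  split_ifs with h
  · simp [h]
  · rw [ENNReal.toReal_inv, ENNReal.toReal_add one_ne_top h]
    have : 0 ≤ x.toReal := ENNReal.toReal_nonneg
    simp only [ENNReal.toReal_one]
    field_simp
    ring

lemma inv_one_add_le_one (x : ℝ≥0∞) : (1 + x)⁻¹ ≤ 1 :=
  ENNReal.inv_le_one.2 le_self_add

lemma inv_one_add_ne_top (x : ℝ≥0∞) : (1 + x)⁻¹ ≠ ∞ :=
  ((inv_one_add_le_one x).trans_lt one_lt_top).ne

lemma sqz_nonneg (x : ℝ≥0∞) : 0 ≤ sqz x := by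
  rw [sqz_eq_one_sub, sub_nonneg, ← ENNReal.toReal_one]
  exact ENNReal.toReal_mono one_ne_top (inv_one_add_le_one x)

lemma sqz_le_one (x : ℝ≥0∞) : sqz x ≤ 1 := by
  rw [sqz_eq_one_sub]
  linarith [ENNReal.toReal_nonneg (a := (1 + x)⁻¹)]

lemma abs_sqz_sub_sqz_le_one (x y : ℝ≥0∞) : |sqz x - sqz y| ≤ 1 := by
  rw [abs_le]
  constructor <;> linarith [sqz_nonneg x, sqz_le_one x, sqz_nonneg y, sqz_le_one y]

lemma continuous_sqz : Continuous sqz := by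
  rw [continuous_iff_continuousAt]
  intro x
  rw [ContinuousAt, funext sqz_eq_one_sub]
  refine tendsto_const_nhds.sub ((ENNReal.tendsto_toReal (inv_one_add_ne_top x)).comp ?_)
  exact tendsto_inv_iff.2 (tendsto_const_nhds.add tendsto_id)

lemma inv_ofReal_one_sub_sqz (x : ℝ≥0∞) : (ENNReal.ofReal (1 - sqz x))⁻¹ - 1 = x := by
  rw [sqz_eq_one_sub, _root_.sub_sub_cancel, ENNReal.ofReal_toReal (inv_one_add_ne_top x), inv_inv,
    ENNReal.add_sub_cancel_left one_ne_top]

lemma tendsto_sqz_iff {ι : Type*} {l : Filter ι} {a : ι → ℝ≥0∞} {b : ℝ≥0∞} :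
    Tendsto (fun i => sqz (a i)) l (𝓝 (sqz b)) ↔ Tendsto a l (𝓝 b) := by
  refine ⟨fun h => ?_, fun h => (continuous_sqz.tendsto b).comp h⟩
  have h₁ : Tendsto (fun i => (ENNReal.ofReal (1 - sqz (a i)))⁻¹ - 1) l
      (𝓝 ((ENNReal.ofReal (1 - sqz b))⁻¹ - 1)) :=
    ENNReal.Tendsto.sub
      (tendsto_inv_iff.2 (ENNReal.tendsto_ofReal (tendsto_const_nhds.sub h)))
      tendsto_const_nhds (Or.inr one_ne_top)
  simpa only [inv_ofReal_one_sub_sqz] using h₁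

end Squeeze

section Distance

variable {X : Type*} [MetricSpace X] {n : ℕ} {pts : ℕ → X × Rn n}

lemma summable_dGamma_weight :
    Summable fun lk : ℕ × ℕ => (2 : ℝ) ^ (-(lk.1 : ℤ) - (lk.2 : ℤ) - 2) := by
  have h := ((summable_geometric_two.mul_of_nonneg summable_geometric_two
    (fun _ => by positivity) (fun _ => by positivity)).mul_right (1 / 4 : ℝ))
  refine h.congr fun lk => ?_
  rw [zpow_sub₀ two_ne_zero, zpow_sub₀ two_ne_zero, zpow_neg]
  simp only [zpow_natCast, one_div, inv_pow]
  norm_num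
  ring

lemma dGamma_term_le (f g : X × Rn n → ℝ≥0∞) (lk : ℕ × ℕ) :
    (2 : ℝ) ^ (-(lk.1 : ℤ) - (lk.2 : ℤ) - 2) *
      |sqz (yosida f ((lk.1 : ℝ) + 1) (pts lk.2).1 (pts lk.2).2) -
        sqz (yosida g ((lk.1 : ℝ) + 1) (pts lk.2).1 (pts lk.2).2)| ≤
      (2 : ℝ) ^ (-(lk.1 : ℤ) - (lk.2 : ℤ) - 2) :=
  mul_le_of_le_one_right (by positivity) (abs_sqz_sub_sqz_le_one _ _)

lemma summable_dGamma (f g : X × Rn n → ℝ≥0∞) :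
    Summable fun lk : ℕ × ℕ => (2 : ℝ) ^ (-(lk.1 : ℤ) - (lk.2 : ℤ) - 2) *
      |sqz (yosida f ((lk.1 : ℝ) + 1) (pts lk.2).1 (pts lk.2).2) -
        sqz (yosida g ((lk.1 : ℝ) + 1) (pts lk.2).1 (pts lk.2).2)| :=
  Summable.of_nonneg_of_le (fun _ => by positivity) (dGamma_term_le f g) summable_dGamma_weight

lemma dGamma_self (f : X × Rn n → ℝ≥0∞) : dGamma pts f f = 0 := by simp [dGamma]

lemma dGamma_comm (f g : X × Rn n → ℝ≥0∞) : dGamma pts f g = dGamma pts g f := by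
  simp only [dGamma, abs_sub_comm]

lemma dGamma_triangle (f g h : X × Rn n → ℝ≥0∞) :
    dGamma pts f h ≤ dGamma pts f g + dGamma pts g h := by
  unfold dGamma
  rw [← (summable_dGamma f g).tsum_add (summable_dGamma g h)]
  refine (summable_dGamma f h).tsum_le_tsum (fun lk => ?_)
    ((summable_dGamma f g).add (summable_dGamma g h))
  rw [← mul_add]
  exact mul_le_mul_of_nonneg_left (abs_sub_le _ _ _) (by positivity)

lemma tendsto_dGamma_zero_iff {F : ℕ → X × Rn n → ℝ≥0∞} {f : X × Rn n → ℝ≥0∞} :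
    Tendsto (fun k => dGamma pts (F k) f) atTop (𝓝 0) ↔
      ∀ l j : ℕ, Tendsto (fun k => yosida (F k) ((l : ℝ) + 1) (pts j).1 (pts j).2) atTop
        (𝓝 (yosida f ((l : ℝ) + 1) (pts j).1 (pts j).2)) := by
  constructor
  · intro h l j
    rw [← tendsto_sqz_iff, tendsto_iff_dist_tendsto_zero]
    have hw : (0 : ℝ) < (2 : ℝ) ^ (-(l : ℤ) - (j : ℤ) - 2) := by positivity
    refine squeeze_zero (fun _ => dist_nonneg) (fun k => ?_)
      (by simpa using h.const_mul ((2 : ℝ) ^ (-(l : ℤ) - (j : ℤ) - 2))⁻¹)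
    rw [← div_eq_inv_mul, le_div_iff₀' hw]
    exact (summable_dGamma (F k) f).le_tsum (l, j) (fun _ _ => by positivity)
  · intro h
    have h₀ : (0 : ℝ) = ∑' _ : ℕ × ℕ, (0 : ℝ) := by simp
    rw [h₀]
    refine tendsto_tsum_of_dominated_convergence summable_dGamma_weight (fun lk => ?_)
      (Eventually.of_forall fun k lk => ?_)
    · have h₁ := tendsto_iff_dist_tendsto_zero.1 (tendsto_sqz_iff.2 (h lk.1 lk.2))
      simpa [Real.dist_eq] using
        h₁.const_mul ((2 : ℝ) ^ (-(lk.1 : ℤ) - (lk.2 : ℤ) - 2))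
    · rw [Real.norm_of_nonneg (by positivity)]
      exact dGamma_term_le (F k) f lk

end Distance

section Gamma

variable {X : Type*} [MetricSpace X] {n : ℕ}

lemma yosida_le (f : X × Rn n → ℝ≥0∞) (lam : ℝ) (u : X) (y : Rn n) (p : X × Rn n) :
    yosida f lam u y ≤ f p + ENNReal.ofReal (lam * (dist u p.1 + dist y p.2)) :=
  iInf_le _ p

lemma dist_le_add_dist (s p : X × Rn n) : dist s p ≤ dist s.1 p.1 + dist s.2 p.2 :=
  max_le_add_of_nonneg dist_nonneg dist_nonneg

lemma add_dist_le_two_mul (s p : X × Rn n) :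
    dist s.1 p.1 + dist s.2 p.2 ≤ 2 * dist s p := by
  rw [two_mul]
  exact add_le_add (le_max_left _ _) (le_max_right _ _)

lemma tendsto_penalty (lam : ℝ) (s : X × Rn n) {p : ℕ → X × Rn n} {q : X × Rn n}
    (hp : Tendsto p atTop (𝓝 q)) :
    Tendsto (fun k => ENNReal.ofReal (lam * (dist s.1 (p k).1 + dist s.2 (p k).2))) atTop
      (𝓝 (ENNReal.ofReal (lam * (dist s.1 q.1 + dist s.2 q.2)))) := by
  have hc : Continuous fun p : X × Rn n =>
      ENNReal.ofReal (lam * (dist s.1 p.1 + dist s.2 p.2)) :=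
    ENNReal.continuous_ofReal.comp (by fun_prop)
  exact (hc.tendsto q).comp hp

/-- A value which is approached arbitrarily well near `q` admits a recovery sequence at `q`. -/
lemma exists_recovery_seq {F : ℕ → X × Rn n → ℝ≥0∞} {q : X × Rn n} {a : ℝ≥0∞}
    (h : ∀ ε > 0, ∀ c > a, ∀ᶠ k in atTop, ∃ p, dist p q < ε ∧ F k p < c) :
    ∃ p : ℕ → X × Rn n, Tendsto p atTop (𝓝 q) ∧
      atTop.limsup (fun k => F k (p k)) ≤ a := by
  rcases eq_or_ne a ∞ with rfl | ha
  · exact ⟨fun _ => q, tendsto_const_nhds, le_top⟩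
  let E : ℕ → X × Rn n → ℝ≥0∞ := fun k p => edist p q + (F k p - a)
  have hE : Tendsto (fun k => ⨅ p, E k p) atTop (𝓝 0) := by
    rw [ENNReal.tendsto_nhds_zero]
    intro ε hε
    obtain ⟨δ, hδ, hδε⟩ := ENNReal.lt_iff_exists_nnreal_btwn.1 (ENNReal.half_pos hε.ne')
    have hδ₀ : (0 : ℝ) < δ := by exact_mod_cast hδ
    filter_upwards [h δ hδ₀ (a + δ) (ENNReal.lt_add_right ha hδ.ne')] with k hk
    obtain ⟨p, hpq, hpF⟩ := hk
    refine (iInf_le _ p).trans ?_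
    rw [← ENNReal.add_halves ε]
    refine add_le_add (le_trans ?_ hδε.le) (le_trans ?_ hδε.le)
    · rw [edist_dist]
      exact ENNReal.ofReal_le_of_le_toReal (by simpa using hpq.le)
    · exact tsub_le_iff_left.2 hpF.le
  have hpick : ∀ k : ℕ, ∃ p, E k p ≤ (⨅ p, E k p) + ((k : ℝ≥0∞) + 1)⁻¹ := by
    intro k
    by_cases ht : (⨅ p, E k p) = ∞
    · exact ⟨q, by simp [ht]⟩
    · have hlt := ENNReal.lt_add_right ht
        (ENNReal.inv_ne_zero.2 (by simp : ((k : ℝ≥0∞) + 1) ≠ ∞))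
      obtain ⟨p, hp⟩ := iInf_lt_iff.1 hlt
      exact ⟨p, hp.le⟩
  choose p hp using hpick
  have hinv : Tendsto (fun k : ℕ => ((k : ℝ≥0∞) + 1)⁻¹) atTop (𝓝 0) := by
    have := (tendsto_add_atTop_iff_nat 1).2 ENNReal.tendsto_inv_nat_nhds_zero
    simpa using this
  have hEp : Tendsto (fun k => E k (p k)) atTop (𝓝 0) :=
    tendsto_of_tendsto_of_tendsto_of_le_of_le tendsto_const_nhds
      (by simpa using hE.add hinv) (fun _ => zero_le) hp
  refine ⟨p, ?_, ?_⟩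
  · rw [tendsto_iff_edist_tendsto_0]
    exact tendsto_of_tendsto_of_tendsto_of_le_of_le tendsto_const_nhds hEp
      (fun _ => zero_le) (fun _ => le_self_add)
  · have hlim : Tendsto (fun k => a + E k (p k)) atTop (𝓝 a) := by
      simpa using hEp.const_add a
    rw [← hlim.limsup_eq]
    refine limsup_le_limsup (Eventually.of_forall fun k => ?_)
    exact le_add_tsub.trans (add_le_add le_rfl le_add_self)

lemma gammaConv_of_eventually {F : ℕ → X × Rn n → ℝ≥0∞} {f : X × Rn n → ℝ≥0∞}
    (hlow : ∀ q, ∀ p : ℕ → X × Rn n, Tendsto p atTop (𝓝 q) → ∀ c < f q,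
      ∀ᶠ k in atTop, c ≤ F k (p k))
    (hup : ∀ q, ∀ ε > 0, ∀ c > f q, ∀ᶠ k in atTop, ∃ p, dist p q < ε ∧ F k p < c) :
    GammaConv F f :=
  ⟨fun p q hp => le_of_forall_lt_imp_le_of_dense fun c hc =>
    le_liminf_of_le (by isBoundedDefault) (hlow q p hp c hc),
    fun q => exists_recovery_seq (hup q)⟩

/-- Γ-compactness: in a separable space every sequence has a Γ-convergent subsequence. -/
lemma exists_gammaConv_subseq [TopologicalSpace.SeparableSpace X] (F : ℕ → X × Rn n → ℝ≥0∞) :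
    ∃ φ : ℕ → ℕ, StrictMono φ ∧ ∃ g : X × Rn n → ℝ≥0∞,
      LowerSemicontinuous g ∧ GammaConv (fun k => F (φ k)) g := by
  have : SecondCountableTopology X := UniformSpace.secondCountable_of_separable X
  let B := TopologicalSpace.countableBasis (X × Rn n)
  have hB := TopologicalSpace.isBasis_countableBasis (X × Rn n)
  have : Countable B := (TopologicalSpace.countable_countableBasis (X × Rn n)).to_subtype
  let I : ℕ → B → ℝ≥0∞ := fun k U => ⨅ p ∈ (U : Set (X × Rn n)), F k p
  obtain ⟨L, φ, hφ, hL⟩ := CompactSpace.tendsto_subseq I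
  rw [tendsto_pi_nhds] at hL
  let g : X × Rn n → ℝ≥0∞ := fun q => ⨆ (U : B) (_ : q ∈ (U : Set (X × Rn n))), L U
  refine ⟨φ, hφ, g, ?_, gammaConv_of_eventually ?_ ?_⟩
  · intro q c hc
    obtain ⟨U, hU⟩ := lt_iSup_iff.1 hc
    obtain ⟨hqU, hcU⟩ := lt_iSup_iff.1 hU
    filter_upwards [(hB.isOpen U.2).mem_nhds hqU] with q' hq'
    exact hcU.trans_le (le_iSup₂_of_le U hq' le_rfl)
  · intro q p hp c hc
    obtain ⟨U, hU⟩ := lt_iSup_iff.1 hc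
    obtain ⟨hqU, hcU⟩ := lt_iSup_iff.1 hU
    filter_upwards [hp.eventually ((hB.isOpen U.2).mem_nhds hqU),
      (hL U).eventually (lt_mem_nhds hcU)] with k hk hck
    exact hck.le.trans (iInf₂_le (p k) hk)
  · intro q ε hε c hc
    obtain ⟨U, hU, hqU, hUε⟩ := hB.mem_nhds_iff.1 (ball_mem_nhds q hε)
    have hLc : L ⟨U, hU⟩ < c := (le_iSup₂_of_le (f := fun (U : B) (_ : q ∈ U.1) => L U)
      ⟨U, hU⟩ hqU le_rfl : L ⟨U, hU⟩ ≤ g q).trans_lt hc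
    filter_upwards [(hL ⟨U, hU⟩).eventually (gt_mem_nhds hLc)] with k hk
    obtain ⟨p, hp⟩ := iInf_lt_iff.1 hk
    obtain ⟨hpU, hpc⟩ := iInf_lt_iff.1 hp
    exact ⟨p, hUε hpU, hpc⟩

/-- Yosida regularizations converge along a Γ-convergent sequence with property (M). -/
lemma GammaConv.tendsto_yosida {Fam : Set (X × Rn n → ℝ≥0∞)} (hM : PropertyM Fam)
    {F : ℕ → X × Rn n → ℝ≥0∞} (hF : ∀ k, F k ∈ Fam) {f : X × Rn n → ℝ≥0∞}
    (h : GammaConv F f) {lam : ℝ} (hlam : 0 < lam) (s : X × Rn n) :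
    Tendsto (fun k => yosida (F k) lam s.1 s.2) atTop (𝓝 (yosida f lam s.1 s.2)) := by
  obtain ⟨_, -, -, K, hK, hKF⟩ := hM
  refine tendsto_order.2 ⟨fun c hc => ?_, fun c hc => ?_⟩
  · by_contra hcon
    obtain ⟨c', hcc', hc'⟩ := ENNReal.lt_iff_exists_nnreal_btwn.1 hc
    have hfreq : ∃ᶠ k in atTop, ∃ p ∈ K c' s.1 s.2 lam,
        F k p + ENNReal.ofReal (lam * (dist s.1 p.1 + dist s.2 p.2)) < c' := by
      refine (not_eventually.1 hcon).mono fun k hk => ?_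
      have hlt : yosida (F k) lam s.1 s.2 < c' := (not_lt.1 hk).trans_lt hcc'
      have hlt' := hlt
      rw [(hKF (F k) (hF k)).2 c' s.1 s.2 lam hlam (by simpa using hlt)] at hlt'
      simpa only [yosidaOn, iInf_lt_iff, exists_prop] using hlt'
    obtain ⟨φ, hφ, hφp⟩ := extraction_of_frequently_atTop hfreq
    choose p hpK hp using hφp
    obtain ⟨q, -, ψ, hψ, hq⟩ := (hK c' s.1 s.2 lam).tendsto_subseq hpK
    have hinj : Function.Injective (φ ∘ ψ) := (hφ.comp hψ).injective
    let r : ℕ → X × Rn n := Function.extend (φ ∘ ψ) (p ∘ ψ) fun _ => q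
    have hr : Tendsto r atTop (𝓝 q) := by
      intro V hV
      obtain ⟨N, hN⟩ := mem_atTop_sets.1 (hq hV)
      refine eventually_atTop.2 ⟨(φ ∘ ψ) N, fun k hk => ?_⟩
      by_cases hex : ∃ j, (φ ∘ ψ) j = k
      · obtain ⟨j, rfl⟩ := hex
        have : r ((φ ∘ ψ) j) = (p ∘ ψ) j := hinj.extend_apply _ _ _
        simpa only [Filter.mem_map, Set.mem_preimage, this] using hN j ((hφ.comp hψ).le_iff_le.1 hk)
      · have : r k = q := Function.extend_apply' _ _ _ hex
        simpa only [Set.mem_preimage, this] using mem_of_mem_nhds hV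
    have hfq : f q + ENNReal.ofReal (lam * (dist s.1 q.1 + dist s.2 q.2)) ≤ c' := by
      have hpen := tendsto_penalty lam s hr
      have hlt : ∃ᶠ k in atTop,
          F k (r k) + ENNReal.ofReal (lam * (dist s.1 (r k).1 + dist s.2 (r k).2)) < c' := by
        refine (hφ.comp hψ).tendsto_atTop.frequently (Frequently.of_forall fun j => ?_)
        have : r ((φ ∘ ψ) j) = p (ψ j) := hinj.extend_apply _ _ _
        rw [this]
        exact hp (ψ j)
      refine add_le_of_le_tsub_right_of_le
        (le_of_tendsto_of_frequently hpen (hlt.mono fun k hk => le_add_self.trans hk.le)) ?_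
      by_contra hcon'
      obtain ⟨b, hb₁, hb₂⟩ := exists_between (not_le.1 hcon')
      have hsub := ENNReal.Tendsto.sub (tendsto_const_nhds (x := (c' : ℝ≥0∞))) hpen
        (Or.inl coe_ne_top)
      obtain ⟨k, hk, hk₁, hk₂⟩ := (hlt.and_eventually ((hsub.eventually (gt_mem_nhds hb₁)).and
        (eventually_lt_of_lt_liminf (hb₂.trans_le (h.1 r q hr))))).exists
      exact absurd (ENNReal.le_sub_of_add_le_right ofReal_ne_top hk.le) (not_le.2 (hk₁.trans hk₂))
    exact absurd (yosida_le f lam s.1 s.2 q) (not_le.2 (hfq.trans_lt hc'))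
  · obtain ⟨q, hq⟩ := iInf_lt_iff.1 hc
    obtain ⟨p, hp, hpf⟩ := h.2 q
    obtain ⟨b, hb₁, hb₂⟩ := exists_between (lt_tsub_iff_right.2 hq)
    have hpen := (tendsto_penalty lam s hp).const_add b
    filter_upwards [eventually_lt_of_limsup_lt (hpf.trans_lt hb₁),
      hpen.eventually (gt_mem_nhds (lt_tsub_iff_right.1 hb₂))] with k hk₁ hk₂
    exact (yosida_le (F k) lam s.1 s.2 (p k)).trans_lt ((add_le_add hk₁.le le_rfl).trans_lt hk₂)

/-- Convergence of the Yosida regularizations at a dense set of points implies Γ-convergence. -/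
lemma gammaConv_of_tendsto_yosida {F : ℕ → X × Rn n → ℝ≥0∞} {f : X × Rn n → ℝ≥0∞}
    (hf : LowerSemicontinuous f) {pts : ℕ → X × Rn n} (hdense : DenseRange pts)
    (h : ∀ l j : ℕ, Tendsto (fun k => yosida (F k) ((l : ℝ) + 1) (pts j).1 (pts j).2) atTop
      (𝓝 (yosida f ((l : ℝ) + 1) (pts j).1 (pts j).2))) :
    GammaConv F f := by
  refine gammaConv_of_eventually (fun q p hp c hc => ?_) (fun q ε hε c hc => ?_)
  · obtain ⟨c₁, hcc₁, hc₁⟩ := ENNReal.lt_iff_exists_nnreal_btwn.1 hc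
    obtain ⟨η, hη, hcη⟩ := ENNReal.lt_iff_exists_add_pos_lt.1 hcc₁
    obtain ⟨r, hr, hball⟩ := Metric.eventually_nhds_iff.1 (hf q c₁ hc₁)
    obtain ⟨l, hl⟩ := exists_nat_gt ((c₁ : ℝ) / (r / 2))
    have hlam : (c₁ : ℝ) ≤ ((l : ℝ) + 1) * (r / 2) := by
      rw [div_lt_iff₀ (half_pos hr)] at hl
      linarith
    have hη' : (0 : ℝ) < η := by exact_mod_cast hη
    have hδ : 0 < min (r / 2) (η / (4 * ((l : ℝ) + 1))) := by positivity
    obtain ⟨j, hj⟩ := hdense.exists_dist_lt q hδ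
    have hj₁ := lt_min_iff.1 hj
    have hyos : (c₁ : ℝ≥0∞) ≤ yosida f ((l : ℝ) + 1) (pts j).1 (pts j).2 := by
      refine le_iInf fun p' => ?_
      by_cases hp' : dist p' q < r
      · exact (hball hp').le.trans le_self_add
      · refine le_trans ?_ le_add_self
        rw [← ENNReal.ofReal_coe_nnreal]
        refine ENNReal.ofReal_le_ofReal (hlam.trans ?_)
        gcongr
        refine le_trans ?_ (dist_le_add_dist (pts j) p')
        have := dist_triangle_left p' q (pts j)
        rw [dist_comm q] at hj₁
        linarith [not_lt.1 hp', hj₁.1]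
    filter_upwards [(h l j).eventually (lt_mem_nhds (hcη.trans_le hyos)),
      (tendsto_iff_dist_tendsto_zero.1 hp).eventually (gt_mem_nhds hδ)] with k hk hpk
    have hpen : ENNReal.ofReal
        (((l : ℝ) + 1) * (dist (pts j).1 (p k).1 + dist (pts j).2 (p k).2)) ≤ η := by
      rw [← ENNReal.ofReal_coe_nnreal]
      refine ENNReal.ofReal_le_ofReal ?_
      have hsum := add_dist_le_two_mul (pts j) (p k)
      have htri := dist_triangle (pts j) q (p k)
      have hpk' := (lt_min_iff.1 hpk).2
      rw [dist_comm (p k)] at hpk'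
      have hqj := hj₁.2
      rw [dist_comm q] at hqj
      have hle : dist (pts j).1 (p k).1 + dist (pts j).2 (p k).2 ≤
          4 * (η / (4 * ((l : ℝ) + 1))) := by linarith
      calc ((l : ℝ) + 1) * (dist (pts j).1 (p k).1 + dist (pts j).2 (p k).2)
          ≤ ((l : ℝ) + 1) * (4 * (η / (4 * ((l : ℝ) + 1)))) := by gcongr
        _ = η := by field_simp
    have hle := hk.le.trans ((yosida_le (F k) _ _ _ (p k)).trans (add_le_add le_rfl hpen))
    exact (ENNReal.add_le_add_iff_right coe_ne_top).1 hle
  · obtain ⟨η, hη, hfη⟩ := ENNReal.lt_iff_exists_add_pos_lt.1 hc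
    have hη' : (0 : ℝ) < η := by exact_mod_cast hη
    have hfq : f q ≠ ∞ := (lt_of_le_of_lt le_self_add hfη).ne_top
    obtain ⟨l, hl⟩ := exists_nat_gt ((f q + η).toReal / (ε / 2))
    have hlam : (f q + η).toReal ≤ ((l : ℝ) + 1) * (ε / 2) := by
      rw [div_lt_iff₀ (half_pos hε)] at hl
      linarith
    have hδ : 0 < min (ε / 2) (η / (2 * ((l : ℝ) + 1))) := by positivity
    obtain ⟨j, hj⟩ := hdense.exists_dist_lt q hδ
    rw [dist_comm, lt_min_iff] at hj
    have hyos : yosida f ((l : ℝ) + 1) (pts j).1 (pts j).2 < f q + η := by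
      refine (yosida_le f _ _ _ q).trans_lt (ENNReal.add_lt_add_left hfq ?_)
      rw [← ENNReal.ofReal_coe_nnreal, ENNReal.ofReal_lt_ofReal_iff hη']
      calc ((l : ℝ) + 1) * (dist (pts j).1 q.1 + dist (pts j).2 q.2)
          ≤ ((l : ℝ) + 1) * (2 * dist (pts j) q) := by
            gcongr
            exact add_dist_le_two_mul _ _
        _ < ((l : ℝ) + 1) * (2 * (η / (2 * ((l : ℝ) + 1)))) := by
            gcongr
            exact hj.2
        _ = η := by field_simp
    filter_upwards [(h l j).eventually (gt_mem_nhds hyos)] with k hk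
    obtain ⟨p, hp⟩ := iInf_lt_iff.1 hk
    refine ⟨p, ?_, (le_self_add.trans_lt hp).trans hfη⟩
    have hpen := (ENNReal.ofReal_lt_iff_lt_toReal (by positivity)
      (ENNReal.add_ne_top.2 ⟨hfq, coe_ne_top⟩)).1 (le_add_self.trans_lt hp)
    have hsum := lt_of_mul_lt_mul_left (hpen.trans_le hlam) (by positivity)
    have htri := dist_triangle_left p q (pts j)
    linarith [dist_le_add_dist (pts j) p, hj.1]

lemma GammaConv.le_of_const {f g : X × Rn n → ℝ≥0∞} (h : GammaConv (fun _ => f) g) : g ≤ f :=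
  fun q => by simpa using h.1 (fun _ => q) q tendsto_const_nhds

end Gamma

/-- For a family `Fam` of lower semicontinuous integrands bounded below by a fixed
coercive lower semicontinuous integrand and having property (M), the quantity `dGamma`
built from a dense sequence of points is a distance on `Fam` which metrizes
Γ-convergence; moreover every sequence in `Fam` has a subsequence Γ-converging to a
lower semicontinuous integrand, and if `Fam` is closed under Γ-convergence then it is
(sequentially) compact for this distance. -/
theorem dGamma_metrizes_gamma_and_compact
    {X : Type*} [MetricSpace X] [CompleteSpace X] [TopologicalSpace.SeparableSpace X] {n : ℕ}
    (Fam : Set (X × Rn n → ℝ≥0∞))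
    (hFamLsc : ∀ f ∈ Fam, LowerSemicontinuous f)
    (f₀ : X × Rn n → ℝ≥0∞) (hf₀lsc : LowerSemicontinuous f₀) (hf₀coer : Coercive f₀)
    (hbelow : ∀ f ∈ Fam, ∀ p, f₀ p ≤ f p)
    (hM : PropertyM Fam)
    (pts : ℕ → X × Rn n) (hdense : DenseRange pts) :
    -- `dGamma` is a distance on `Fam`
    (∀ f ∈ Fam, dGamma pts f f = 0) ∧
    (∀ f ∈ Fam, ∀ g ∈ Fam, dGamma pts f g = dGamma pts g f) ∧
    (∀ f ∈ Fam, ∀ g ∈ Fam, ∀ h ∈ Fam,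
      dGamma pts f h ≤ dGamma pts f g + dGamma pts g h) ∧
    (∀ f ∈ Fam, ∀ g ∈ Fam, dGamma pts f g = 0 → f = g) ∧
    -- `dGamma` metrizes Γ-convergence on `Fam`
    (∀ F : ℕ → X × Rn n → ℝ≥0∞, (∀ k, F k ∈ Fam) → ∀ f ∈ Fam,
      (Tendsto (fun k => dGamma pts (F k) f) atTop (𝓝 0) ↔ GammaConv F f)) ∧
    -- every sequence in `Fam` has a Γ-convergent subsequence
    (∀ F : ℕ → X × Rn n → ℝ≥0∞, (∀ k, F k ∈ Fam) →
      ∃ φ : ℕ → ℕ, StrictMono φ ∧ ∃ g : X × Rn n → ℝ≥0∞,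
        LowerSemicontinuous g ∧ GammaConv (fun k => F (φ k)) g) ∧
    -- if `Fam` is closed under Γ-convergence, it is sequentially compact
    ((∀ F : ℕ → X × Rn n → ℝ≥0∞, (∀ k, F k ∈ Fam) →
        ∀ g : X × Rn n → ℝ≥0∞, GammaConv F g → g ∈ Fam) →
      ∀ F : ℕ → X × Rn n → ℝ≥0∞, (∀ k, F k ∈ Fam) →
        ∃ φ : ℕ → ℕ, StrictMono φ ∧ ∃ g ∈ Fam, GammaConv (fun k => F (φ k)) g) := by
  have metrizes : ∀ F : ℕ → X × Rn n → ℝ≥0∞, (∀ k, F k ∈ Fam) → ∀ f ∈ Fam,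
      (Tendsto (fun k => dGamma pts (F k) f) atTop (𝓝 0) ↔ GammaConv F f) := by
    intro F hF f hf
    rw [tendsto_dGamma_zero_iff]
    exact ⟨gammaConv_of_tendsto_yosida (hFamLsc f hf) hdense,
      fun h l j => h.tendsto_yosida hM hF (by positivity) (pts j)⟩
  have le_of_dGamma : ∀ f ∈ Fam, ∀ g ∈ Fam, dGamma pts f g = 0 → g ≤ f := fun f hf g hg h =>
    ((metrizes (fun _ => f) (fun _ => hf) g hg).1 (by simp [h])).le_of_const
  refine ⟨fun f _ => dGamma_self f, fun f _ g _ => dGamma_comm f g,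
    fun f _ g _ h _ => dGamma_triangle f g h, fun f hf g hg h => ?_, metrizes,
    fun F _ => exists_gammaConv_subseq F, fun hclosed F hF => ?_⟩
  · exact le_antisymm (le_of_dGamma g hg f hf (dGamma_comm g f ▸ h)) (le_of_dGamma f hf g hg h)
  · obtain ⟨φ, hφ, g, -, hg⟩ := exists_gammaConv_subseq F
    exact ⟨φ, hφ, g, hclosed _ (fun k => hF (φ k)) g hg, hg⟩
end
end

section
/- In the stationary random setting, assume additionally that the family {f_ε^{ω,x}} is uniformly measurable with respect to x. If E_ε^ω(u_ε) ≤ C for all ε and ε_n → 0 is a sequence with P_{ε_n}^ω converging weakly to P^ω, then P^ω is invariant under the ℝⁿ-action θ_y(x,f,u) = (x, θ_y f, θ_y u) on G̅ × F × X: for every y ∈ ℝⁿ and every bounded continuous φ, ∫ φ(x,f,u) dP^ω = ∫ φ(x, θ_y f, θ_y u) dP^ω. -/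
open Filter Topology MeasureTheory Metric ENNReal

noncomputable section

/-- The random energy `E_ε^ω(u)`: the average over `x ∈ G` of `f_ε^{ω,x}(u, x/ε)`,
where the integrand `f_ε^{ω,x}` is the element `F ε ω x` of the functional space `𝓕`,
realized as an integrand through the map `e`. -/
def energyE {X : Type*} [MetricSpace X] {n : ℕ} {Ω : Type*} {𝓕 : Type*}
    (e : 𝓕 → X × Rn n → ℝ≥0∞) (F : ℝ → Ω → Rn n → 𝓕) (G : Set (Rn n))
    (ε : ℝ) (ω : Ω) (u : X) : ℝ≥0∞ :=
  (∫⁻ x in G, e (F ε ω x) (u, ε⁻¹ • x)) / volume G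

/-- The Young measure at scale `ε`: the push-forward of the normalized Lebesgue measure
on `G` by the map `x ↦ (x, θ_{x/ε} f_ε^{ω,x}, θ_{x/ε} u)`. -/
def Pmeas {X : Type*} [MetricSpace X] [MeasurableSpace X] {n : ℕ} {Ω : Type*}
    {𝓕 : Type*} [MeasurableSpace 𝓕]
    (θ : Rn n → X → X) (θF : Rn n → 𝓕 → 𝓕) (F : ℝ → Ω → Rn n → 𝓕) (G : Set (Rn n))
    (ε : ℝ) (ω : Ω) (u : X) : Measure (Rn n × 𝓕 × X) :=
  Measure.map (fun x => (x, θF (ε⁻¹ • x) (F ε ω x), θ (ε⁻¹ • x) u))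
    ((volume G)⁻¹ • volume.restrict G)

/-- Weak convergence (narrow convergence) of a sequence of measures, expressed by
testing against bounded continuous functions. -/
def WeakLim {α : Type*} [TopologicalSpace α] [MeasurableSpace α]
    (P : ℕ → Measure α) (Q : Measure α) : Prop :=
  ∀ φ : BoundedContinuousFunction α ℝ,
    Tendsto (fun k => ∫ a, φ a ∂(P k)) atTop (𝓝 (∫ a, φ a ∂Q))

/-- If two bounded functions are `η`-close on the intersection of their domains outside a set
`N`, their integrals differ by little. -/
lemma norm_setIntegral_sub_setIntegral_le {α : Type*} [MeasurableSpace α] {m : Measure α}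
    {S T N : Set α} (hS : MeasurableSet S) (hT : MeasurableSet T)
    (hSfin : m S ≠ ∞) (hTfin : m T ≠ ∞) (hNfin : m N ≠ ∞)
    {a b : α → ℝ} {M η : ℝ} (hη : 0 ≤ η) (ha : AEStronglyMeasurable a (m.restrict S))
    (hb : AEStronglyMeasurable b (m.restrict T)) (haM : ∀ x, ‖a x‖ ≤ M) (hbM : ∀ x, ‖b x‖ ≤ M)
    (hab : ∀ x ∈ S, x ∈ T → x ∉ N → ‖a x - b x‖ ≤ η) :
    ‖∫ x in S, a x ∂m - ∫ x in T, b x ∂m‖ ≤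
      2 * M * m.real (symmDiff S T) + 2 * M * m.real N + η * m.real T := by
  have hai : IntegrableOn a S m :=
    IntegrableOn.of_bound hSfin.lt_top ha M (Eventually.of_forall haM)
  have hbi : IntegrableOn b T m :=
    IntegrableOn.of_bound hTfin.lt_top hb M (Eventually.of_forall hbM)
  set D := symmDiff S T
  set N' := toMeasurable m N
  have hD : MeasurableSet D := hS.symmDiff hT
  have hN' : MeasurableSet N' := measurableSet_toMeasurable m N
  have hDfin : m D ≠ ∞ := measure_ne_top_of_subset Set.symmDiff_subset_union
    (measure_union_ne_top hSfin hTfin)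
  have hN'fin : m N' ≠ ∞ := by rwa [measure_toMeasurable]
  have hgD : Integrable (D.indicator fun _ => 2 * M) m :=
    (integrable_indicator_iff hD).2 (integrableOn_const hDfin)
  have hgN : Integrable (N'.indicator fun _ => 2 * M) m :=
    (integrable_indicator_iff hN').2 (integrableOn_const hN'fin)
  have hgT : Integrable (T.indicator fun _ => η) m :=
    (integrable_indicator_iff hT).2 (integrableOn_const hTfin)
  rw [← integral_indicator hS, ← integral_indicator hT,
    ← integral_sub ((integrable_indicator_iff hS).2 hai) ((integrable_indicator_iff hT).2 hbi)]
  refine (norm_integral_le_of_norm_le ((hgD.add hgN).add hgT)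
    (Eventually.of_forall fun x => ?_)).trans_eq ?_
  · have hM : 0 ≤ M := (norm_nonneg _).trans (haM x)
    have hD0 : 0 ≤ D.indicator (fun _ => 2 * M) x := Set.indicator_nonneg (by intros; positivity) x
    have hN0 : 0 ≤ N'.indicator (fun _ => 2 * M) x :=
      Set.indicator_nonneg (by intros; positivity) x
    have hT0 : 0 ≤ T.indicator (fun _ => η) x := Set.indicator_nonneg (fun _ _ => hη) x
    have h1 := haM x
    have h2 := hbM x
    have h3 : ‖a x - b x‖ ≤ 2 * M := (norm_sub_le _ _).trans (by linarith)
    simp only [Pi.add_apply]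
    by_cases hxS : x ∈ S <;> by_cases hxT : x ∈ T
    · by_cases hxN : x ∈ N
      · have : x ∈ N' := subset_toMeasurable m N hxN
        simp only [Set.indicator_of_mem hxS, Set.indicator_of_mem hxT,
          Set.indicator_of_mem this] at *
        linarith
      · have := hab x hxS hxT hxN
        simp only [Set.indicator_of_mem hxS, Set.indicator_of_mem hxT] at *
        linarith
    · have : x ∈ D := Or.inl ⟨hxS, hxT⟩
      simp only [Set.indicator_of_mem hxS, Set.indicator_of_notMem hxT,
        Set.indicator_of_mem this, sub_zero] at *
      linarith
    · have : x ∈ D := Or.inr ⟨hxT, hxS⟩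
      simp only [Set.indicator_of_notMem hxS, Set.indicator_of_mem hxT,
        Set.indicator_of_mem this, zero_sub, norm_neg] at *
      linarith
    · simp only [Set.indicator_of_notMem hxS, Set.indicator_of_notMem hxT, sub_zero, norm_zero] at *
      linarith
  · rw [integral_add' (hgD.add hgN) hgT, integral_add' hgD hgN, integral_indicator_const _ hD,
      integral_indicator_const _ hN', integral_indicator_const _ hT]
    simp only [smul_eq_mul, Measure.real, N', measure_toMeasurable]
    ring

/-- Integrals over `G` of two bounded sequences have the same asymptotics if, after a
vanishing translation, the sequences become close in measure. -/
lemma tendsto_setIntegral_sub_setIntegral_of_shift {E : Type*} [NormedAddCommGroup E]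
    [MeasurableSpace E] [BorelSpace E] [SecondCountableTopology E] [LocallyCompactSpace E]
    {m : Measure E} [m.IsAddHaarMeasure] {G : Set E} (hG : MeasurableSet G) (hGfin : m G ≠ ∞)
    {h : ℕ → E} (hh : Tendsto h atTop (𝓝 0)) {A B : ℕ → E → ℝ} {M : ℝ}
    (hA : ∀ᶠ k in atTop, AEStronglyMeasurable (A k) (m.restrict G))
    (hB : ∀ᶠ k in atTop, AEStronglyMeasurable (B k) (m.restrict G))
    (hAM : ∀ k x, ‖A k x‖ ≤ M) (hBM : ∀ k x, ‖B k x‖ ≤ M)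
    (hAB : ∀ η > 0, ∀ᶠ k in atTop,
      m {x | x ∈ G ∧ η < ‖A k (x + h k) - B k x‖} < ENNReal.ofReal η) :
    Tendsto (fun k => ∫ x in G, A k x ∂m - ∫ x in G, B k x ∂m) atTop (𝓝 0) := by
  have hM : 0 ≤ M := (norm_nonneg _).trans (hAM 0 0)
  have hmp : ∀ k, MeasurePreserving (fun x => x + h k) m m :=
    fun k => measurePreserving_add_right m (h k)
  have hsymm : Tendsto (fun k => m.real (symmDiff ((fun x => x + h k) ⁻¹' G) G)) atTop (𝓝 0) := by
    have hcont : Continuous fun p : E × E => p.2 + p.1 := by fun_prop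
    let τ : C(E, C(E, E)) := ContinuousMap.curry ⟨fun p : E × E => p.2 + p.1, hcont⟩
    have hτ : Tendsto (fun k => τ (h k)) atTop (𝓝 (τ 0)) := (τ.continuous.tendsto 0).comp hh
    have key := tendsto_measure_symmDiff_preimage_nhds_zero (μ := m) (ν := m) (s := G) hτ
      (Eventually.of_forall hmp) (measurePreserving_add_right m 0) hG.nullMeasurableSet hGfin
    have h0 : (τ 0) ⁻¹' G = G := by ext x; simp [τ]
    rw [h0] at key
    refine (ENNReal.tendsto_toReal_zero_iff fun k => ?_).2 key
    refine measure_ne_top_of_subset Set.symmDiff_subset_union (measure_union_ne_top ?_ hGfin)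
    rwa [(hmp k).measure_preimage hG.nullMeasurableSet]
  rw [Metric.tendsto_nhds]
  intro ρ hρ
  obtain ⟨η, hη, hηρ⟩ : ∃ η > 0, 2 * M * η + 2 * M * η + η * m.real G < ρ := by
    have hG0 : 0 ≤ m.real G := measureReal_nonneg
    refine ⟨ρ / (2 * (4 * M + m.real G + 1)), by positivity, ?_⟩
    have : (4 * M + m.real G) / (2 * (4 * M + m.real G + 1)) < 1 := by
      rw [div_lt_one (by positivity)]
      linarith
    calc _ = ρ * ((4 * M + m.real G) / (2 * (4 * M + m.real G + 1))) := by ring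
      _ < ρ * 1 := by gcongr
      _ = ρ := mul_one ρ
  filter_upwards [hA, hB, hAB η hη, hsymm.eventually (gt_mem_nhds hη)] with k hAk hBk hNk hDk
  set N := {x | x ∈ G ∧ η < ‖A k (x + h k) - B k x‖}
  have hemb : MeasurableEmbedding (fun x : E => x + h k) := measurableEmbedding_addRight (h k)
  have hAk' : AEStronglyMeasurable (fun x => A k (x + h k))
      (m.restrict ((fun x => x + h k) ⁻¹' G)) :=
    hAk.comp_measurePreserving ((hmp k).restrict_preimage_emb hemb G)
  have hNreal : m.real N ≤ η := ENNReal.toReal_le_of_le_ofReal hη.le hNk.le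
  rw [dist_zero_right, ← (hmp k).setIntegral_preimage_emb hemb (A k) G]
  refine (norm_setIntegral_sub_setIntegral_le (N := N) ((hmp k).measurable hG) hG ?_ hGfin
    (hNk.trans_le le_top).ne hη.le hAk' hBk (fun x => hAM k _) (hBM k)
    fun x _ hxG hxN => ?_).trans_lt (lt_of_le_of_lt ?_ hηρ)
  · rwa [(hmp k).measure_preimage hG.nullMeasurableSet]
  · exact not_lt.1 fun hlt => hxN ⟨hxG, hlt⟩
  · gcongr

/-- Translation of integrands is compatible with Γ-convergence. -/
lemma GammaConv.translate {X : Type*} [MetricSpace X] {n : ℕ} {θ : Rn n → X → X}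
    (hθ_zero : ∀ u : X, θ 0 u = u)
    (hθ_add : ∀ (y z : Rn n) (u : X), θ (y + z) u = θ y (θ z u))
    (hθ_cont : ∀ y, Continuous (θ y)) {F : ℕ → X × Rn n → ℝ≥0∞} {f : X × Rn n → ℝ≥0∞}
    (hF : GammaConv F f) (y : Rn n) :
    GammaConv (fun k => actInt θ y (F k)) (actInt θ y f) := by
  have hT : ∀ z : Rn n, Continuous fun p : X × Rn n => (θ (-z) p.1, p.2 + z) :=
    fun z => ((hθ_cont (-z)).comp continuous_fst).prodMk (continuous_snd.add continuous_const)
  refine ⟨fun p q hpq => hF.1 _ _ (((hT y).tendsto q).comp hpq), fun q => ?_⟩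
  obtain ⟨p, hp, hlim⟩ := hF.2 (θ (-y) q.1, q.2 + y)
  refine ⟨fun k => (θ (- -y) (p k).1, (p k).2 + -y), ?_, ?_⟩
  · have := ((hT (-y)).tendsto _).comp hp
    simpa [← hθ_add, hθ_zero] using! this
  · simpa [actInt, ← hθ_add, hθ_zero] using hlim

/-- Two probability measures which agree on bounded Lipschitz functions are equal. -/
lemma probabilityMeasure_ext_of_lipschitz {α : Type*} [MetricSpace α] [MeasurableSpace α]
    [BorelSpace α] {P Q : ProbabilityMeasure α}
    (h : ∀ f : BoundedContinuousFunction α ℝ, (∃ L, LipschitzWith L f) →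
      ∫ a, f a ∂(P : Measure α) = ∫ a, f a ∂(Q : Measure α)) : P = Q := by
  have : Tendsto (fun _ : ℕ => P) atTop (𝓝 Q) := by
    rw [tendsto_iff_forall_lipschitz_integral_tendsto]
    rintro f ⟨C, hC⟩ ⟨L, hL⟩
    have := h (BoundedContinuousFunction.mkOfBound ⟨f, hL.continuous⟩ C hC) ⟨L, hL⟩
    simp only [BoundedContinuousFunction.mkOfBound_coe, ContinuousMap.coe_mk] at this
    rw [this]
    exact tendsto_const_nhds
  exact tendsto_nhds_unique tendsto_const_nhds this

/-- In the stationary random setting with uniform measurability, any weak limit `P^ω`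
of the Young measures `P_{ε_k}^ω` along a sequence `ε_k → 0` is invariant under the
action `θ_y (x,f,u) = (x, θ_y f, θ_y u)` of `ℝⁿ` on `G̅ × 𝓕 × X`. -/
theorem young_measure_invariant
    {X : Type*} [MetricSpace X] [CompleteSpace X] [TopologicalSpace.SeparableSpace X]
    [MeasurableSpace X] [BorelSpace X] {n : ℕ}
    {Ω : Type*} [MeasurableSpace Ω]
    {𝓕 : Type*} [MetricSpace 𝓕] [CompactSpace 𝓕] [MeasurableSpace 𝓕] [BorelSpace 𝓕]
    (μ : Measure Ω) (hμ : IsProbabilityMeasure μ)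
    (act : Rn n → Ω → Ω)
    (hact_zero : ∀ ω, act 0 ω = ω)
    (hact_add : ∀ (y z : Rn n) (ω : Ω), act y (act z ω) = act (y + z) ω)
    (hact_mp : ∀ y, MeasurePreserving (act y) μ μ)
    (θ : Rn n → X → X)
    (hθ_zero : ∀ u : X, θ 0 u = u)
    (hθ_add : ∀ (y z : Rn n) (u : X), θ (y + z) u = θ y (θ z u))
    (hθ_cont_y : ∀ u : X, Continuous fun y => θ y u)
    (hθ_cont_u : ∀ K : Set (Rn n), IsCompact K → ∀ u : X, ∀ ε > 0, ∃ δ > 0,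
      ∀ v : X, dist v u < δ → ∀ y ∈ K, dist (θ y v) (θ y u) < ε)
    (e : 𝓕 → X × Rn n → ℝ≥0∞) (he_inj : Function.Injective e)
    (he_lsc : ∀ φ : 𝓕, LowerSemicontinuous (e φ))
    (hmetrize : ∀ (g : ℕ → 𝓕) (glim : 𝓕),
      Tendsto g atTop (𝓝 glim) ↔ GammaConv (fun k => e (g k)) (e glim))
    (θF : Rn n → 𝓕 → 𝓕) (hθF : ∀ (y : Rn n) (φ : 𝓕), e (θF y φ) = actInt θ y (e φ))
    (f₀ : X × Rn n → ℝ≥0∞) (hf₀lsc : LowerSemicontinuous f₀) (hf₀coer : Coercive f₀)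
    (hbelow : ∀ (φ : 𝓕) (p : X × Rn n), f₀ p ≤ e φ p)
    (hPM : PropertyM (Set.range e))
    (F : ℝ → Ω → Rn n → 𝓕)
    (hFmeas : ∀ (ε : ℝ) (ω : Ω), Measurable (F ε ω))
    (hstat : ∀ (ε : ℝ) (ω : Ω) (x y : Rn n), θF y (F ε ω x) = F ε (act y ω) x)
    (G : Set (Rn n)) (hGopen : IsOpen G) (hGbdd : Bornology.IsBounded G)
    (hGvol : 0 < volume G)
    -- uniform measurability of the family with respect to x
    (hUM : ∀ δ > 0, ∀ η > 0, ∃ r > 0, ∀ h : Rn n, ‖h‖ < r → ∀ ε > 0,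
      volume {x | x ∈ G ∧ ∃ ω : Ω, δ < dist (F ε ω x) (F ε ω (x + h))} <
        ENNReal.ofReal η)
    (ω : Ω) (u : ℝ → X) (C : ℝ≥0∞) (hC : C ≠ ∞)
    (hbound : ∀ ε > 0, energyE e F G ε ω (u ε) ≤ C)
    (εs : ℕ → ℝ) (hεpos : ∀ k, 0 < εs k) (hεlim : Tendsto εs atTop (𝓝 0))
    (P : Measure (Rn n × 𝓕 × X)) (hP : IsProbabilityMeasure P)
    (hweak : WeakLim (fun k => Pmeas θ θF F G (εs k) ω (u (εs k))) P) :
    ∀ y : Rn n, ∀ φ : BoundedContinuousFunction (Rn n × 𝓕 × X) ℝ,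
      ∫ p, φ p ∂P = ∫ p, φ (p.1, θF y p.2.1, θ y p.2.2) ∂P := by
  have : SecondCountableTopology X := UniformSpace.secondCountable_of_separable X
  intro y φ
  have hGfin : volume G ≠ ∞ := hGbdd.measure_lt_top.ne
  have hθc : ∀ z, Continuous (θ z) := fun z => Metric.continuous_iff.2 fun v ρ hρ => by
    obtain ⟨δ, hδ, h⟩ := hθ_cont_u {z} isCompact_singleton v ρ hρ
    exact ⟨δ, hδ, fun w hw => h w hw z rfl⟩
  have hθFc : ∀ z, Continuous (θF z) := fun z => continuous_iff_seqContinuous.2 fun g g₀ hg => by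
    rw [hmetrize] at hg ⊢
    simpa only [Function.comp_apply, hθF] using hg.translate hθ_zero hθ_add hθc z
  let T : Rn n × 𝓕 × X → Rn n × 𝓕 × X := fun p => (p.1, θF y p.2.1, θ y p.2.2)
  have hT : Continuous T := continuous_fst.prodMk
    (((hθFc y).comp (continuous_fst.comp continuous_snd)).prodMk
      ((hθc y).comp (continuous_snd.comp continuous_snd)))
  let Φ : ℕ → Rn n → Rn n × 𝓕 × X := fun k x =>
    (x, θF ((εs k)⁻¹ • x) (F (εs k) ω x), θ ((εs k)⁻¹ • x) (u (εs k)))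
  let ν : Measure (Rn n) := (volume G)⁻¹ • volume.restrict G
  have hΦ : ∀ᶠ k in atTop, AEMeasurable (Φ k) (volume.restrict G) := by
    have h1 := hweak (BoundedContinuousFunction.const _ 1)
    simp only [BoundedContinuousFunction.const_apply, integral_const, probReal_univ,
      one_smul] at h1
    filter_upwards [h1.eventually (lt_mem_nhds zero_lt_one)] with k hk
    by_contra hnot
    have hnot' : ¬ AEMeasurable (Φ k) ν := fun h => hnot
      (h.mono_ac (Measure.absolutelyContinuous_smul (ENNReal.inv_ne_zero.2 hGfin)))
    have hmap : Pmeas θ θF F G (εs k) ω (u (εs k)) = 0 := Measure.map_of_not_aemeasurable hnot'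
    simp [hmap] at hk
  have hint : ∀ ψ : BoundedContinuousFunction (Rn n × 𝓕 × X) ℝ, ∀ᶠ k in atTop,
      ∫ p, ψ p ∂(Pmeas θ θF F G (εs k) ω (u (εs k))) =
        ((volume G)⁻¹).toReal * ∫ x in G, ψ (Φ k x) := by
    intro ψ
    filter_upwards [hΦ] with k hk
    have hk' : AEMeasurable (Φ k) ν := hk.smul_measure _
    refine (integral_map hk' ψ.continuous.measurable.aestronglyMeasurable).trans ?_
    rw [integral_smul_measure, smul_eq_mul]
  have hclose : ∀ ψ : BoundedContinuousFunction (Rn n × 𝓕 × X) ℝ, (∃ L, LipschitzWith L ψ) →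
      Tendsto (fun k => (∫ x in G, ψ (Φ k x)) - ∫ x in G, ψ (T (Φ k x))) atTop (𝓝 0) := by
    rintro ψ ⟨L, hL⟩
    have hh : Tendsto (fun k => εs k • y) atTop (𝓝 0) := by
      simpa using hεlim.smul_const y
    refine tendsto_setIntegral_sub_setIntegral_of_shift (M := ‖ψ‖)
      (A := fun k x => ψ (Φ k x)) (B := fun k x => ψ (T (Φ k x))) hGopen.measurableSet hGfin hh
      ?_ ?_ (fun k x => ψ.norm_coe_le_norm _) (fun k x => ψ.norm_coe_le_norm _) fun η hη => ?_
    · filter_upwards [hΦ] with k hk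
      exact (ψ.continuous.measurable.comp_aemeasurable hk).aestronglyMeasurable
    · filter_upwards [hΦ] with k hk
      exact ((ψ.continuous.comp hT).measurable.comp_aemeasurable hk).aestronglyMeasurable
    · have hL1 : (0 : ℝ) < L + 1 := by positivity
      set δ := η / (L + 1) with hδ_def
      have hδ : 0 < δ := by positivity
      obtain ⟨r, hr, hUMr⟩ := hUM δ hδ η hη
      have hsmall : ∀ᶠ k in atTop, ‖εs k • y‖ < min r δ :=
        (tendsto_zero_iff_norm_tendsto_zero.1 hh).eventually (gt_mem_nhds (lt_min hr hδ))
      filter_upwards [hsmall] with k hk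
      refine (measure_mono fun x hx => ?_).trans_lt
        (hUMr (εs k • y) (hk.trans_le (min_le_left _ _)) (εs k) (hεpos k))
      obtain ⟨hxG, hlt⟩ := hx
      refine ⟨hxG, act ((εs k)⁻¹ • x + y) ω, ?_⟩
      by_contra! hle
      refine hlt.not_ge ?_
      have harg : (εs k)⁻¹ • (x + εs k • y) = (εs k)⁻¹ • x + y := by
        rw [smul_add, inv_smul_smul₀ (hεpos k).ne']
      have hΦ1 : Φ k (x + εs k • y) = (x + εs k • y,
          F (εs k) (act ((εs k)⁻¹ • x + y) ω) (x + εs k • y),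
          θ ((εs k)⁻¹ • x + y) (u (εs k))) := by
        simp only [Φ, harg, hstat]
      have hΦ2 : T (Φ k x) = (x, F (εs k) (act ((εs k)⁻¹ • x + y) ω) x,
          θ ((εs k)⁻¹ • x + y) (u (εs k))) := by
        simp only [T, Φ, hstat, hact_add, ← hθ_add, add_comm y]
      have hdist : dist (Φ k (x + εs k • y)) (T (Φ k x)) ≤ δ := by
        rw [hΦ1, hΦ2, Prod.dist_eq, Prod.dist_eq]
        refine max_le ?_ (max_le ?_ ?_)
        · simpa [dist_eq_norm] using (hk.trans_le (min_le_right _ _)).le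
        · rw [dist_comm]
          exact hle
        · simpa using hδ.le
      calc ‖ψ (Φ k (x + εs k • y)) - ψ (T (Φ k x))‖
          ≤ L * dist (Φ k (x + εs k • y)) (T (Φ k x)) := by
            rw [← dist_eq_norm]
            exact hL.dist_le_mul _ _
        _ ≤ (L + 1) * δ := by
            gcongr
            linarith
        _ = η := mul_div_cancel₀ _ hL1.ne'
  have hmapP : IsProbabilityMeasure (P.map T) :=
    Measure.isProbabilityMeasure_map hT.measurable.aemeasurable
  have hinv : (⟨P, hP⟩ : ProbabilityMeasure (Rn n × 𝓕 × X)) = ⟨P.map T, hmapP⟩ := by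
    refine probabilityMeasure_ext_of_lipschitz fun ψ hψ => ?_
    change ∫ p, ψ p ∂P = ∫ p, ψ p ∂(P.map T)
    rw [integral_map hT.measurable.aemeasurable ψ.continuous.measurable.aestronglyMeasurable]
    let ψT := ψ.compContinuous ⟨T, hT⟩
    have hlim : Tendsto (fun k => ∫ p, ψ p ∂(Pmeas θ θF F G (εs k) ω (u (εs k))) -
        ∫ p, ψT p ∂(Pmeas θ θF F G (εs k) ω (u (εs k)))) atTop
        (𝓝 (∫ p, ψ p ∂P - ∫ p, ψT p ∂P)) := (hweak ψ).sub (hweak ψT)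
    have hlim0 := (hclose ψ hψ).const_mul ((volume G)⁻¹).toReal
    rw [mul_zero] at hlim0
    refine sub_eq_zero.1 (tendsto_nhds_unique hlim (hlim0.congr' ?_))
    filter_upwards [hint ψ, hint ψT] with k h1 h2
    rw [h1, h2, mul_sub]
    rfl
  have hPT : P = P.map T := congrArg Subtype.val hinv
  calc ∫ p, φ p ∂P = ∫ p, φ p ∂(P.map T) := by rw [← hPT]
    _ = ∫ p, φ (T p) ∂P :=
      integral_map hT.measurable.aemeasurable φ.continuous.measurable.aestronglyMeasurable
end
end

section
/- In the stationary random setting with uniform measurability, assume E_ε^ω(u_ε) ≤ C for all ε, and let ε_n → 0 be such that P_{ε_n}^ω converges weakly to P^ω. Then for every y ∈ ℝⁿ, P_{ε_n}^{ω+y} converges weakly to P^{ω+y}, where P^{ω+y} is the push-forward of P^ω by the map (x,f,u) ↦ (x, f, θ_{−y} u). In particular, denoting by Q^ω the marginal of P^ω with respect to the first two variables (x,f), one has Q^{ω+y} = Q^ω for all y ∈ ℝⁿ. -/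
open Filter Topology MeasureTheory Metric ENNReal

noncomputable section

/-- If a function `a`, translated by `t`, is `c`-close to `b` on `G` outside a set `B`, then
the integrals of `a` and `b` over `G` are close. -/
lemma abs_setIntegral_sub_le_of_translate {n : ℕ} {G B : Set (Rn n)} {a b : Rn n → ℝ}
    {M c : ℝ} {t : Rn n} (hG : MeasurableSet G) (hGfin : volume G ≠ ∞) (hB : volume B ≠ ∞)
    (ha : Measurable a) (hb : Measurable b) (haM : ∀ x, |a x| ≤ M) (hbM : ∀ x, |b x| ≤ M)
    (hc : 0 ≤ c) (hab : ∀ x ∈ G, x ∉ B → |a (x - t) - b x| ≤ c) :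
    |(∫ x in G, a x) - ∫ x in G, b x| ≤
      M * volume.real (symmDiff ((fun x => x - t) ⁻¹' G) G) + 2 * M * volume.real B +
        c * volume.real G := by
  set T : Set (Rn n) := (fun x => x - t) ⁻¹' G with hT
  set B' := toMeasurable volume B with hB'
  have hM : 0 ≤ M := (abs_nonneg _).trans (haM 0)
  have hmp : MeasurePreserving (fun x : Rn n => x - t) volume volume :=
    measurePreserving_sub_right volume t
  have hTm : MeasurableSet T := hmp.measurable hG
  have hTfin : volume T ≠ ∞ := by rwa [hT, hmp.measure_preimage hG.nullMeasurableSet]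
  have hB'm : MeasurableSet B' := measurableSet_toMeasurable _ _
  have hB'v : volume.real B' = volume.real B := by
    simp [hB', Measure.real, measure_toMeasurable]
  have hB'fin : volume B' ≠ ∞ := by rwa [hB', measure_toMeasurable]
  have hSm : MeasurableSet (symmDiff T G) := hTm.symmDiff hG
  have hSfin : volume (symmDiff T G) ≠ ∞ := measure_symmDiff_ne_top hTfin hGfin
  have ham : Measurable fun x => a (x - t) := ha.comp hmp.measurable
  have hia : Integrable (T.indicator fun x => a (x - t)) := by
    rw [integrable_indicator_iff hTm]
    exact Measure.integrableOn_of_bounded hTfin ham.aestronglyMeasurable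
      (Eventually.of_forall fun x => haM _)
  have hib : Integrable (G.indicator b) := by
    rw [integrable_indicator_iff hG]
    exact Measure.integrableOn_of_bounded hGfin hb.aestronglyMeasurable
      (Eventually.of_forall fun x => hbM _)
  have hshift : ∫ x in G, a x = ∫ x in T, a (x - t) :=
    (hmp.setIntegral_preimage_emb (measurableEmbedding_subRight t) a G).symm
  rw [hshift, ← integral_indicator hTm, ← integral_indicator hG, ← integral_sub hia hib]
  have hi {s : Set (Rn n)} (hs : MeasurableSet s) (hf : volume s ≠ ∞) (r : ℝ) :
      Integrable (s.indicator fun _ => r) :=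
    (integrable_indicator_iff hs).2 (integrableOn_const hf)
  have hbd : ∫ x, ((symmDiff T G).indicator (fun _ => M) x + B'.indicator (fun _ => 2 * M) x +
      G.indicator (fun _ => c) x) =
      M * volume.real (symmDiff T G) + 2 * M * volume.real B + c * volume.real G := by
    have hadd := (hi hSm hSfin M).add (hi hB'm hB'fin (2 * M))
    simp only [Pi.add_def] at hadd
    rw [integral_add hadd (hi hG hGfin c), integral_add (hi hSm hSfin M) (hi hB'm hB'fin _), integral_indicator_const _ hSm,
      integral_indicator_const _ hB'm, integral_indicator_const _ hG, hB'v]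
    simp only [smul_eq_mul]
    ring
  rw [← hbd, ← Real.norm_eq_abs]
  refine norm_integral_le_of_norm_le
    (((hi hSm hSfin M).add (hi hB'm hB'fin _)).add (hi hG hGfin c))
    (Eventually.of_forall fun x => ?_)
  rw [Real.norm_eq_abs]
  have hB0 : 0 ≤ B'.indicator (fun _ => 2 * M) x :=
    Set.indicator_nonneg (fun _ _ => by positivity) x
  by_cases hxT : x ∈ T <;> by_cases hxG : x ∈ G
  · have hxS : x ∉ symmDiff T G := by simp [Set.mem_symmDiff, hxT, hxG]
    by_cases hxB : x ∈ B'
    · simp only [hxT, hxG, hxS, hxB, Set.indicator_of_mem, Set.indicator_of_notMem,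
        not_false_eq_true]
      have := abs_sub (a (x - t)) (b x)
      linarith [haM (x - t), hbM x]
    · have := hab x hxG fun h => hxB (subset_toMeasurable _ _ h)
      simpa [hxT, hxG, hxS, hxB] using this
  · have hxS : x ∈ symmDiff T G := by simp [Set.mem_symmDiff, hxT, hxG]
    simp only [hxT, hxG, hxS, Set.indicator_of_mem, Set.indicator_of_notMem,
      not_false_eq_true, sub_zero]
    linarith [haM (x - t)]
  · have hxS : x ∈ symmDiff T G := by simp [Set.mem_symmDiff, hxT, hxG]
    simp only [hxT, hxG, hxS, Set.indicator_of_mem, Set.indicator_of_notMem,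
      not_false_eq_true, zero_sub, abs_neg]
    linarith [hbM x]
  · have hxS : x ∉ symmDiff T G := by simp [Set.mem_symmDiff, hxT, hxG]
    simp only [hxT, hxG, hxS, Set.indicator_of_notMem, not_false_eq_true, sub_self, abs_zero]
    linarith

/-- The measure of the symmetric difference of a set of finite measure and its translates
tends to zero with the translation. -/
lemma tendsto_measureReal_symmDiff_translate {n : ℕ} {G : Set (Rn n)}
    (hG : MeasurableSet G) (hGfin : volume G ≠ ∞) :
    Tendsto (fun t : Rn n => volume.real (symmDiff ((fun x => x - t) ⁻¹' G) G)) (𝓝 0) (𝓝 0) := by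
  let f : Rn n → C(Rn n, Rn n) := fun t => ⟨fun x => x - t, by fun_prop⟩
  have hf : Continuous f :=
    ContinuousMap.continuous_of_continuous_uncurry _ (by
      change Continuous fun p : Rn n × Rn n => p.2 - p.1
      fun_prop)
  have h := tendsto_measure_symmDiff_preimage_nhds_zero (μ := (volume : Measure (Rn n)))
    (ν := (volume : Measure (Rn n))) (hf.tendsto 0)
    (Eventually.of_forall fun t => measurePreserving_sub_right volume t)
    (measurePreserving_sub_right volume 0) hG.nullMeasurableSet hGfin
  have h' := (ENNReal.tendsto_toReal ENNReal.zero_ne_top).comp h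
  simpa [f, Measure.real, Function.comp_def] using h'

/-- A group action which is continuous in time and equicontinuous in space, locally uniformly
in time, is jointly continuous. -/
lemma continuous_uncurry_action {X : Type*} [MetricSpace X] {n : ℕ} {θ : Rn n → X → X}
    (hθ_cont_y : ∀ u : X, Continuous fun y => θ y u)
    (hθ_cont_u : ∀ K : Set (Rn n), IsCompact K → ∀ u : X, ∀ ε > 0, ∃ δ > 0,
      ∀ v : X, dist v u < δ → ∀ y ∈ K, dist (θ y v) (θ y u) < ε) :
    Continuous fun p : Rn n × X => θ p.1 p.2 := by
  refine continuous_iff_continuousAt.2 fun ⟨y, u⟩ => Metric.tendsto_nhds.2 fun ε hε => ?_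
  obtain ⟨δ, hδ, H⟩ := hθ_cont_u _ (isCompact_closedBall y 1) u (ε / 2) (half_pos hε)
  have h1 : ∀ᶠ p : Rn n × X in 𝓝 (y, u), p.1 ∈ closedBall y 1 :=
    continuous_fst.continuousAt.eventually (closedBall_mem_nhds y one_pos)
  have h2 : ∀ᶠ p : Rn n × X in 𝓝 (y, u), dist p.2 u < δ :=
    continuous_snd.continuousAt.eventually (p := fun v => dist v u < δ) (ball_mem_nhds u hδ)
  have h3 : ∀ᶠ p : Rn n × X in 𝓝 (y, u), dist (θ p.1 u) (θ y u) < ε / 2 :=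
    ((hθ_cont_y u).comp continuous_fst).continuousAt.eventually
      (p := fun v => dist v (θ y u) < ε / 2) (ball_mem_nhds (θ y u) (half_pos hε))
  filter_upwards [h1, h2, h3] with p hp1 hp2 hp3
  linarith [H p.2 hp2 p.1 hp1, dist_triangle (θ p.1 p.2) (θ p.1 u) (θ y u)]

/-- The action induced on a space of integrands metrizing Γ-convergence is jointly
continuous. -/
lemma continuous_uncurry_integrand_action {X : Type*} [MetricSpace X] {n : ℕ}
    {𝓕 : Type*} [MetricSpace 𝓕] {θ : Rn n → X → X}
    (hθ_zero : ∀ u : X, θ 0 u = u)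
    (hθ_add : ∀ (y z : Rn n) (u : X), θ (y + z) u = θ y (θ z u))
    (hθ : Continuous fun p : Rn n × X => θ p.1 p.2)
    {e : 𝓕 → X × Rn n → ℝ≥0∞}
    (hmetrize : ∀ (g : ℕ → 𝓕) (glim : 𝓕),
      Tendsto g atTop (𝓝 glim) ↔ GammaConv (fun k => e (g k)) (e glim))
    {θF : Rn n → 𝓕 → 𝓕} (hθF : ∀ (y : Rn n) (φ : 𝓕), e (θF y φ) = actInt θ y (e φ)) :
    Continuous fun p : Rn n × 𝓕 => θF p.1 p.2 := by
  refine continuous_iff_seqContinuous.2 fun s ⟨y, φ⟩ hs => ?_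
  have hs1 : Tendsto (fun k => (s k).1) atTop (𝓝 y) := (continuous_fst.tendsto _).comp hs
  have hs2 : Tendsto (fun k => (s k).2) atTop (𝓝 φ) := (continuous_snd.tendsto _).comp hs
  have hΓ := (hmetrize _ _).1 hs2
  have hact {w : ℕ → Rn n} {v : ℕ → X} {w₀ : Rn n} {v₀ : X} (hw : Tendsto w atTop (𝓝 w₀))
      (hv : Tendsto v atTop (𝓝 v₀)) : Tendsto (fun k => θ (w k) (v k)) atTop (𝓝 (θ w₀ v₀)) :=
    (hθ.tendsto (w₀, v₀)).comp (hw.prodMk_nhds hv)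
  refine (hmetrize _ _).2 ⟨fun p q hpq => ?_, fun q => ?_⟩
  · simp only [Function.comp_apply, hθF]
    have hp1 : Tendsto (fun k => (p k).1) atTop (𝓝 q.1) := (continuous_fst.tendsto _).comp hpq
    have hp2 : Tendsto (fun k => (p k).2) atTop (𝓝 q.2) := (continuous_snd.tendsto _).comp hpq
    exact hΓ.1 (fun k => (θ (-(s k).1) (p k).1, (p k).2 + (s k).1)) (θ (-y) q.1, q.2 + y)
      ((hact hs1.neg hp1).prodMk_nhds (hp2.add hs1))
  · obtain ⟨p, hp, hle⟩ := hΓ.2 (θ (-y) q.1, q.2 + y)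
    have hp1 : Tendsto (fun k => (p k).1) atTop (𝓝 (θ (-y) q.1)) :=
      (continuous_fst.tendsto _).comp hp
    have hp2 : Tendsto (fun k => (p k).2) atTop (𝓝 (q.2 + y)) :=
      (continuous_snd.tendsto _).comp hp
    refine ⟨fun k => (θ (s k).1 (p k).1, (p k).2 - (s k).1), ?_, ?_⟩
    · have h := (hact hs1 hp1).prodMk_nhds (hp2.sub hs1)
      simpa [← hθ_add, hθ_zero] using h
    · simpa [hθF, actInt, ← hθ_add, hθ_zero] using hle

/-- Weak convergence of probability measures can be tested on bounded Lipschitz functions. -/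
lemma weakLim_of_forall_lipschitz {α : Type*} [MetricSpace α] [MeasurableSpace α]
    [OpensMeasurableSpace α] {P : ℕ → Measure α} {Q : Measure α}
    (hP : ∀ k, IsProbabilityMeasure (P k)) (hQ : IsProbabilityMeasure Q)
    (h : ∀ (φ : BoundedContinuousFunction α ℝ) (L : NNReal), LipschitzWith L φ →
      Tendsto (fun k => ∫ a, φ a ∂(P k)) atTop (𝓝 (∫ a, φ a ∂Q))) : WeakLim P Q := by
  let P' : ℕ → ProbabilityMeasure α := fun k => ⟨P k, hP k⟩
  let Q' : ProbabilityMeasure α := ⟨Q, hQ⟩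
  have hlim : Tendsto P' atTop (𝓝 Q') := by
    refine tendsto_iff_forall_lipschitz_integral_tendsto.2 fun f ⟨C, hf⟩ ⟨L, hL⟩ => ?_
    exact h ⟨⟨f, hL.continuous⟩, C, hf⟩ L hL
  exact ProbabilityMeasure.tendsto_iff_forall_integral_tendsto.1 hlim

/-- Integration against the Young measure `Pmeas`. -/
lemma integral_Pmeas {X : Type*} [MetricSpace X] [MeasurableSpace X] {n : ℕ} {Ω : Type*}
    {𝓕 : Type*} [MeasurableSpace 𝓕] {θ : Rn n → X → X} {θF : Rn n → 𝓕 → 𝓕}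
    {F : ℝ → Ω → Rn n → 𝓕} {G : Set (Rn n)} {ε : ℝ} {ω : Ω} {u : X}
    (hm : Measurable fun x : Rn n => (x, θF (ε⁻¹ • x) (F ε ω x), θ (ε⁻¹ • x) u))
    {φ : Rn n × 𝓕 × X → ℝ} (hφ : Measurable φ) :
    ∫ p, φ p ∂(Pmeas θ θF F G ε ω u) =
      (volume.real G)⁻¹ * ∫ x in G, φ (x, θF (ε⁻¹ • x) (F ε ω x), θ (ε⁻¹ • x) u) := by
  rw [Pmeas, integral_map hm.aemeasurable hφ.aestronglyMeasurable, integral_smul_measure,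
    ENNReal.toReal_inv, smul_eq_mul, Measure.real]

/-- In the stationary random setting with uniform measurability, if `P_{ε_k}^ω` converges
weakly to `P^ω`, then for every `y ∈ ℝⁿ` the measures `P_{ε_k}^{ω+y}` converge weakly to
`P^{ω+y}`, the push-forward of `P^ω` by `(x,f,u) ↦ (x,f,θ_{-y}u)`; in particular the
marginal `Q^ω` of `P^ω` with respect to the first two variables satisfies
`Q^{ω+y} = Q^ω`. -/
theorem young_measure_translate_omega
    {X : Type*} [MetricSpace X] [CompleteSpace X] [TopologicalSpace.SeparableSpace X]
    [MeasurableSpace X] [BorelSpace X] {n : ℕ}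
    {Ω : Type*} [MeasurableSpace Ω]
    {𝓕 : Type*} [MetricSpace 𝓕] [CompactSpace 𝓕] [MeasurableSpace 𝓕] [BorelSpace 𝓕]
    (μ : Measure Ω) (hμ : IsProbabilityMeasure μ)
    (act : Rn n → Ω → Ω)
    (hact_zero : ∀ ω, act 0 ω = ω)
    (hact_add : ∀ (y z : Rn n) (ω : Ω), act y (act z ω) = act (y + z) ω)
    (hact_mp : ∀ y, MeasurePreserving (act y) μ μ)
    (θ : Rn n → X → X)
    (hθ_zero : ∀ u : X, θ 0 u = u)
    (hθ_add : ∀ (y z : Rn n) (u : X), θ (y + z) u = θ y (θ z u))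
    (hθ_cont_y : ∀ u : X, Continuous fun y => θ y u)
    (hθ_cont_u : ∀ K : Set (Rn n), IsCompact K → ∀ u : X, ∀ ε > 0, ∃ δ > 0,
      ∀ v : X, dist v u < δ → ∀ y ∈ K, dist (θ y v) (θ y u) < ε)
    (e : 𝓕 → X × Rn n → ℝ≥0∞) (he_inj : Function.Injective e)
    (he_lsc : ∀ φ : 𝓕, LowerSemicontinuous (e φ))
    (hmetrize : ∀ (g : ℕ → 𝓕) (glim : 𝓕),
      Tendsto g atTop (𝓝 glim) ↔ GammaConv (fun k => e (g k)) (e glim))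
    (θF : Rn n → 𝓕 → 𝓕) (hθF : ∀ (y : Rn n) (φ : 𝓕), e (θF y φ) = actInt θ y (e φ))
    (f₀ : X × Rn n → ℝ≥0∞) (hf₀lsc : LowerSemicontinuous f₀) (hf₀coer : Coercive f₀)
    (hbelow : ∀ (φ : 𝓕) (p : X × Rn n), f₀ p ≤ e φ p)
    (hPM : PropertyM (Set.range e))
    (F : ℝ → Ω → Rn n → 𝓕)
    (hFmeas : ∀ (ε : ℝ) (ω : Ω), Measurable (F ε ω))
    (hstat : ∀ (ε : ℝ) (ω : Ω) (x y : Rn n), θF y (F ε ω x) = F ε (act y ω) x)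
    (G : Set (Rn n)) (hGopen : IsOpen G) (hGbdd : Bornology.IsBounded G)
    (hGvol : 0 < volume G)
    (hUM : ∀ δ > 0, ∀ η > 0, ∃ r > 0, ∀ h : Rn n, ‖h‖ < r → ∀ ε > 0,
      volume {x | x ∈ G ∧ ∃ ω : Ω, δ < dist (F ε ω x) (F ε ω (x + h))} <
        ENNReal.ofReal η)
    (ω : Ω) (u : ℝ → X) (C : ℝ≥0∞) (hC : C ≠ ∞)
    (hbound : ∀ ε > 0, energyE e F G ε ω (u ε) ≤ C)
    (εs : ℕ → ℝ) (hεpos : ∀ k, 0 < εs k) (hεlim : Tendsto εs atTop (𝓝 0))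
    (P : Measure (Rn n × 𝓕 × X)) (hP : IsProbabilityMeasure P)
    (hweak : WeakLim (fun k => Pmeas θ θF F G (εs k) ω (u (εs k))) P) :
    ∀ y : Rn n,
      WeakLim (fun k => Pmeas θ θF F G (εs k) (act y ω) (u (εs k)))
        (Measure.map (fun p : Rn n × 𝓕 × X => (p.1, p.2.1, θ (-y) p.2.2)) P) ∧
      Measure.map (fun p : Rn n × 𝓕 × X => (p.1, p.2.1))
          (Measure.map (fun p : Rn n × 𝓕 × X => (p.1, p.2.1, θ (-y) p.2.2)) P) =
        Measure.map (fun p : Rn n × 𝓕 × X => (p.1, p.2.1)) P := by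
  intro y
  have := UniformSpace.secondCountable_of_separable X
  have hθ := continuous_uncurry_action hθ_cont_y hθ_cont_u
  have hθFc := continuous_uncurry_integrand_action hθ_zero hθ_add hθ hmetrize hθF
  have hGm : MeasurableSet G := hGopen.measurableSet
  have hGfin : volume G ≠ ∞ := hGbdd.measure_lt_top.ne
  have hTc : Continuous fun p : Rn n × 𝓕 × X => (p.1, p.2.1, θ (-y) p.2.2) := by
    have h : Continuous fun p : Rn n × 𝓕 × X => θ (-y) p.2.2 :=
      hθ.comp (continuous_const.prodMk continuous_snd.snd)
    fun_prop
  have hmeas (ε : ℝ) (ω : Ω) (v : X) :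
      Measurable fun x : Rn n => (x, θF (ε⁻¹ • x) (F ε ω x), θ (ε⁻¹ • x) v) := by
    have h1 : Measurable fun x : Rn n => θF (ε⁻¹ • x) (F ε ω x) :=
      hθFc.measurable.comp ((measurable_const_smul ε⁻¹).prodMk (hFmeas ε ω))
    have h2 : Measurable fun x : Rn n => θ (ε⁻¹ • x) v :=
      ((hθ_cont_y v).comp (continuous_const_smul ε⁻¹)).measurable
    exact measurable_id.prodMk (h1.prodMk h2)
  refine ⟨weakLim_of_forall_lipschitz (fun k => ?_)
    (Measure.isProbabilityMeasure_map hTc.measurable.aemeasurable) fun φ L hL => ?_, ?_⟩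
  · have : IsProbabilityMeasure ((volume G)⁻¹ • volume.restrict G) :=
      ⟨by simp [ENNReal.inv_mul_cancel hGvol.ne' hGfin]⟩
    exact Measure.isProbabilityMeasure_map (hmeas _ _ _).aemeasurable
  · set a : ℕ → Rn n → ℝ := fun k x =>
      φ (x, θF ((εs k)⁻¹ • x) (F (εs k) (act y ω) x), θ ((εs k)⁻¹ • x) (u (εs k)))
    set b : ℕ → Rn n → ℝ := fun k x =>
      φ (x, θF ((εs k)⁻¹ • x) (F (εs k) ω x), θ (-y) (θ ((εs k)⁻¹ • x) (u (εs k))))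
    have hφm : Measurable φ := φ.continuous.measurable
    have ham (k) : Measurable (a k) := hφm.comp (hmeas _ _ _)
    have hbm (k) : Measurable (b k) := (hφm.comp hTc.measurable).comp (hmeas _ _ _)
    have hblim : Tendsto (fun k => (volume.real G)⁻¹ * ∫ x in G, b k x) atTop
        (𝓝 (∫ p, φ p ∂(Measure.map (fun p : Rn n × 𝓕 × X => (p.1, p.2.1, θ (-y) p.2.2)) P))) := by
      rw [integral_map hTc.measurable.aemeasurable hφm.aestronglyMeasurable]
      refine (hweak (φ.compContinuous ⟨_, hTc⟩)).congr fun k => ?_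
      rw [integral_Pmeas (hmeas _ _ _) (BoundedContinuousFunction.continuous _).measurable]
      rfl
    have hclose (k : ℕ) (x : Rn n) (δ : ℝ) (hδ : εs k * ‖y‖ ≤ δ)
        (hx : ¬ ∃ ω' : Ω, δ < dist (F (εs k) ω' x) (F (εs k) ω' (x + -(εs k • y)))) :
        |a k (x - εs k • y) - b k x| ≤ L * δ := by
      have hε : εs k ≠ 0 := (hεpos k).ne'
      have hδ0 : 0 ≤ δ := (mul_nonneg (hεpos k).le (norm_nonneg y)).trans hδ
      push Not at hx
      rw [← Real.dist_eq]
      refine (hL.dist_le_mul _ _).trans (mul_le_mul_of_nonneg_left ?_ L.coe_nonneg)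
      have harg : (εs k)⁻¹ • (x - εs k • y) = -y + (εs k)⁻¹ • x := by
        rw [smul_sub, inv_smul_smul₀ hε]
        abel
      rw [harg, hstat, hstat, hact_add, ← hθ_add, Prod.dist_eq, Prod.dist_eq, dist_self]
      refine max_le ?_ (max_le ?_ hδ0)
      · simpa [dist_eq_norm, norm_smul, abs_of_pos (hεpos k)] using hδ
      · have : -y + (εs k)⁻¹ • x + y = (εs k)⁻¹ • x := by abel
        rw [this, dist_comm, sub_eq_add_neg]
        exact hx _
    have htlim : Tendsto (fun k => εs k • y) atTop (𝓝 0) := by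
      simpa using hεlim.smul_const y
    have hdiff : Tendsto (fun k => (∫ x in G, a k x) - ∫ x in G, b k x) atTop (𝓝 0) := by
      set K : ℝ := 3 * ‖φ‖ + L * volume.real G with hK
      have hK0 : 0 ≤ K := by positivity
      refine Metric.tendsto_nhds.2 fun η hη => ?_
      set δ : ℝ := η / (K + 1) with hδdef
      have hδ : 0 < δ := by positivity
      obtain ⟨r, hr, hUMr⟩ := hUM δ hδ δ hδ
      have hn : Tendsto (fun k => ‖εs k • y‖) atTop (𝓝 0) := by simpa using htlim.norm
      filter_upwards [hn.eventually_lt_const hr, hn.eventually_lt_const hδ,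
        ((tendsto_measureReal_symmDiff_translate hGm hGfin).comp htlim).eventually_lt_const hδ]
        with k hk1 hk2 hk3
      have hBlt := hUMr (-(εs k • y)) (by rwa [norm_neg]) (εs k) (hεpos k)
      set B := {x | x ∈ G ∧ ∃ ω' : Ω,
        δ < dist (F (εs k) ω' x) (F (εs k) ω' (x + -(εs k • y)))}
      have hBr : volume.real B ≤ δ := ENNReal.toReal_le_of_le_ofReal hδ.le hBlt.le
      have hle := abs_setIntegral_sub_le_of_translate (t := εs k • y) hGm hGfin
        (hBlt.trans ENNReal.ofReal_lt_top).ne (ham k) (hbm k)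
        (fun x => φ.norm_coe_le_norm _) (fun x => φ.norm_coe_le_norm _)
        (mul_nonneg L.coe_nonneg hδ.le) fun x hxG hxB =>
          hclose k x δ (by
            rw [norm_smul, Real.norm_of_nonneg (hεpos k).le] at hk2
            exact hk2.le) fun h => hxB ⟨hxG, h⟩
      have hKδ : K * δ < η := by
        rw [hδdef, mul_div_assoc', div_lt_iff₀ (by positivity)]
        nlinarith
      rw [Real.dist_eq, sub_zero]
      calc _ ≤ _ := hle
        _ ≤ ‖φ‖ * δ + 2 * ‖φ‖ * δ + L * δ * volume.real G := by
          gcongr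
          exact hk3.le
        _ = K * δ := by rw [hK]; ring
        _ < η := hKδ
    have hsum := (hdiff.const_mul (volume.real G)⁻¹).add hblim
    rw [mul_zero, zero_add] at hsum
    refine hsum.congr fun k => ?_
    rw [integral_Pmeas (hmeas _ _ _) hφm]
    ring
  · rw [Measure.map_map (by fun_prop) hTc.measurable]
    rfl
end
end

section
/- Let X be the set of functions u : ℝ → ℝ whose derivative u' belongs to BV_loc(ℝ, {±1}) (sawtooth functions), and for R > 0, m > 0, A₀ > 0 and a measurable function a(ω,·) with 1 ≤ a ≤ 2, set f^ω_{R,m}(u) = (1/R)( A₀ ‖u'‖_{BV(−R/2,R/2)} + m ∫_{−R/2}^{R/2} a(ω,t) u(t)² dt ). If u is a minimizer of f^ω_{R,m} over X, with R > 1 and 0 < α ≤ m ≤ β, then there is a constant M depending only on α and β such that |u(t)| ≤ M for all t ∈ [−R/2, R/2]. -/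
open Filter Topology MeasureTheory Metric ENNReal

noncomputable section

/-- A sawtooth function on `ℝ`: `u` is the integral of a `±1`-valued function `g` of
locally bounded variation, i.e. `u' ∈ BV_loc(ℝ, ±1)`. -/
def SawtoothLoc (u g : ℝ → ℝ) : Prop :=
  (∀ t, g t = 1 ∨ g t = -1) ∧
  (∀ s₁ s₂ : ℝ, u s₂ = u s₁ + ∫ t in s₁..s₂, g t) ∧
  ∀ b₁ b₂ : ℝ, eVariationOn g (Set.Icc b₁ b₂) < ∞

/-- The sharp interface functional
`f^ω_{R,m}(u) = (1/R)(A₀‖u'‖_{BV(-R/2,R/2)} + m ∫_{-R/2}^{R/2} a(t) u(t)² dt)`,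
evaluated on a sawtooth function `u` with derivative representative `g`. -/
def fRm (A₀ : ℝ) (a : ℝ → ℝ) (R mval : ℝ) (u g : ℝ → ℝ) : ℝ≥0∞ :=
  ENNReal.ofReal R⁻¹ *
    (ENNReal.ofReal A₀ * eVariationOn g (Set.Ioo (-(R / 2)) (R / 2)) +
      ENNReal.ofReal mval *
        ∫⁻ t in Set.Ioo (-(R / 2)) (R / 2), ENNReal.ofReal (a t * u t ^ 2))

/-- If the increments of `h` are controlled by those of `g` and of a monotone function `k` with
values in `[b, c]`, then the variation of `h` exceeds that of `g` by at most `c - b`. -/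
theorem eVariationOn_le_add_of_monotone {g h k : ℝ → ℝ} {b c : ℝ} (hk : Monotone k)
    (hb : ∀ x, b ≤ k x) (hc : ∀ x, k x ≤ c)
    (hgh : ∀ x y, x ≤ y → edist (h y) (h x) ≤ edist (g y) (g x) + ENNReal.ofReal (k y - k x))
    (S : Set ℝ) : eVariationOn h S ≤ eVariationOn g S + ENNReal.ofReal (c - b) := by
  refine iSup_le ?_
  rintro ⟨n, w, hw, hwS⟩
  calc ∑ i ∈ Finset.range n, edist (h (w (i + 1))) (h (w i))
      ≤ ∑ i ∈ Finset.range n, (edist (g (w (i + 1))) (g (w i))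
          + ENNReal.ofReal (k (w (i + 1)) - k (w i))) :=
        Finset.sum_le_sum fun i _ => hgh _ _ (hw (Nat.le_succ i))
    _ = ∑ i ∈ Finset.range n, edist (g (w (i + 1))) (g (w i))
          + ENNReal.ofReal (k (w n) - k (w 0)) := by
        rw [Finset.sum_add_distrib, ← ENNReal.ofReal_sum_of_nonneg
          fun i _ => sub_nonneg.2 (hk (hw (Nat.le_succ i))),
          Finset.sum_range_sub (fun i => k (w i))]
    _ ≤ _ := by
        gcongr
        · exact eVariationOn.sum_le hw hwS
        · exact hc _
        · exact hb _

/-- The function `g`, overwritten on `[p, p + N s)` by alternating values `-1, 1, -1, …` on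
consecutive intervals of length `s`. -/
def alternatingOn (p s : ℝ) (N : ℤ) (g : ℝ → ℝ) (x : ℝ) : ℝ :=
  if 0 ≤ ⌊(x - p) / s⌋ ∧ ⌊(x - p) / s⌋ < N then
    if Even ⌊(x - p) / s⌋ then -1 else 1
  else g x

theorem alternatingOn_eq_one_or {p s : ℝ} {N : ℤ} {g : ℝ → ℝ} (hg : ∀ t, g t = 1 ∨ g t = -1)
    (t : ℝ) : alternatingOn p s N g t = 1 ∨ alternatingOn p s N g t = -1 := by
  unfold alternatingOn
  split_ifs <;> simp [hg]

theorem eVariationOn_alternatingOn_le {p s : ℝ} {N : ℤ} {g : ℝ → ℝ} (hs : 0 < s) (hN : 0 ≤ N)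
    (hg : ∀ t, g t = 1 ∨ g t = -1) (S : Set ℝ) :
    eVariationOn (alternatingOn p s N g) S
      ≤ eVariationOn g S + ENNReal.ofReal (2 * N - (-2)) := by
  have hfl : Monotone fun x : ℝ => ⌊(x - p) / s⌋ := fun x y hxy => by
    dsimp only
    gcongr
  refine eVariationOn_le_add_of_monotone
    (k := fun x => 2 * ((max (-1) (min ⌊(x - p) / s⌋ N) : ℤ) : ℝ)) ?_ ?_ ?_ ?_ S
  · intro x y hxy
    have : ⌊(x - p) / s⌋ ≤ ⌊(y - p) / s⌋ := hfl hxy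
    dsimp only
    gcongr
  · intro x
    have : (-1 : ℤ) ≤ max (-1) (min ⌊(x - p) / s⌋ N) := le_max_left _ _
    have : (-1 : ℝ) ≤ ((max (-1) (min ⌊(x - p) / s⌋ N) : ℤ) : ℝ) := by exact_mod_cast this
    linarith
  · intro x
    have : max (-1) (min ⌊(x - p) / s⌋ N) ≤ N := by omega
    have : ((max (-1) (min ⌊(x - p) / s⌋ N) : ℤ) : ℝ) ≤ N := by exact_mod_cast this
    linarith
  · intro x y hxy
    have hj : ⌊(x - p) / s⌋ ≤ ⌊(y - p) / s⌋ := hfl hxy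
    by_cases heq : max (-1) (min ⌊(x - p) / s⌋ N) = max (-1) (min ⌊(y - p) / s⌋ N)
    · refine le_add_of_le_of_nonneg ?_ zero_le
      unfold alternatingOn
      by_cases hx : 0 ≤ ⌊(x - p) / s⌋ ∧ ⌊(x - p) / s⌋ < N
      · have hxy' : ⌊(x - p) / s⌋ = ⌊(y - p) / s⌋ := by omega
        rw [if_pos hx, if_pos (hxy' ▸ hx), hxy', edist_self]
        exact zero_le
      · have hy : ¬ (0 ≤ ⌊(y - p) / s⌋ ∧ ⌊(y - p) / s⌋ < N) := by omega
        rw [if_neg hx, if_neg hy]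
    · refine le_add_of_nonneg_of_le zero_le ?_
      have hlt : max (-1) (min ⌊(x - p) / s⌋ N) + 1 ≤ max (-1) (min ⌊(y - p) / s⌋ N) := by omega
      have hlt' : ((max (-1) (min ⌊(x - p) / s⌋ N) : ℤ) : ℝ) + 1
          ≤ ((max (-1) (min ⌊(y - p) / s⌋ N) : ℤ) : ℝ) := by exact_mod_cast hlt
      rw [edist_dist]
      refine ENNReal.ofReal_le_ofReal ?_
      have : dist (alternatingOn p s N g y) (alternatingOn p s N g x) ≤ 2 := by
        rw [Real.dist_eq, abs_le]
        rcases alternatingOn_eq_one_or (p := p) (s := s) (N := N) hg x with h | h <;>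
        rcases alternatingOn_eq_one_or (p := p) (s := s) (N := N) hg y with h' | h' <;>
        rw [h, h'] <;> norm_num
      linarith

theorem alternatingOn_of_floor {p s x : ℝ} {N j : ℤ} {g : ℝ → ℝ} (hs : 0 < s) (hj : 0 ≤ j)
    (hjN : j < N) (h₁ : p + j * s ≤ x) (h₂ : x < p + (j + 1) * s) :
    alternatingOn p s N g x = if Even j then -1 else 1 := by
  have : ⌊(x - p) / s⌋ = j := by
    rw [Int.floor_eq_iff, le_div_iff₀ hs, div_lt_iff₀ hs]
    constructor <;> linarith
  simp [alternatingOn, this, hj, hjN]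

theorem alternatingOn_of_lt {p s x : ℝ} {N : ℤ} {g : ℝ → ℝ} (hs : 0 < s) (hx : x < p) :
    alternatingOn p s N g x = g x := by
  refine if_neg fun h => ?_
  have := Int.floor_nonneg.1 h.1
  have : (x - p) / s < 0 := div_neg_of_neg_of_pos (by linarith) hs
  linarith

theorem alternatingOn_of_ge {p s x : ℝ} {N : ℤ} {g : ℝ → ℝ} (hs : 0 < s) (hx : p + N * s ≤ x) :
    alternatingOn p s N g x = g x := by
  refine if_neg fun h => absurd h.2 (not_lt.2 ?_)
  rw [Int.le_floor, le_div_iff₀ hs]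
  linarith

/-- A function of locally bounded variation is interval integrable. -/
theorem intervalIntegrable_of_eVariationOn_lt_top {g : ℝ → ℝ}
    (hv : ∀ b₁ b₂ : ℝ, eVariationOn g (Set.Icc b₁ b₂) < ∞) (b c : ℝ) :
    IntervalIntegrable g volume b c := by
  have hl : LocallyBoundedVariationOn g Set.univ := fun b c _ _ => by
    rw [Set.univ_inter]
    exact (hv b c).ne
  obtain ⟨f₁, f₂, h₁, h₂, h⟩ := hl.exists_monotoneOn_sub_monotoneOn
  rw [h]
  exact (h₁.mono (Set.subset_univ _)).intervalIntegrable.sub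
    (h₂.mono (Set.subset_univ _)).intervalIntegrable

theorem SawtoothLoc.abs_sub_le {u g : ℝ → ℝ} (h : SawtoothLoc u g) (x y : ℝ) :
    |u y - u x| ≤ |y - x| := by
  rw [h.2.1 x y, add_sub_cancel_left]
  have := intervalIntegral.norm_integral_le_of_norm_le_const (a := x) (b := y) (f := g) (C := 1)
    fun t _ => by rcases h.1 t with h | h <;> simp [h]
  simpa using this

theorem SawtoothLoc.continuous {u g : ℝ → ℝ} (h : SawtoothLoc u g) : Continuous u :=
  (LipschitzWith.of_dist_le_mul (K := 1) fun x y => by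
    simpa [Real.dist_eq] using h.abs_sub_le y x).continuous

/-- A `±1`-valued function of locally bounded variation is the derivative of a sawtooth function
with prescribed value at a point. -/
theorem sawtoothLoc_primitive {g : ℝ → ℝ} (hg : ∀ t, g t = 1 ∨ g t = -1)
    (hv : ∀ b₁ b₂ : ℝ, eVariationOn g (Set.Icc b₁ b₂) < ∞) (p L : ℝ) :
    SawtoothLoc (fun t => L + ∫ x in p..t, g x) g := by
  refine ⟨hg, fun x y => ?_, hv⟩
  have hi := intervalIntegrable_of_eVariationOn_lt_top hv
  rw [add_assoc, intervalIntegral.integral_add_adjacent_intervals (hi _ _) (hi _ _)]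

theorem SawtoothLoc.neg {u g : ℝ → ℝ} (h : SawtoothLoc u g) :
    SawtoothLoc (fun t => -u t) (fun t => -g t) := by
  refine ⟨fun t => ?_, fun x y => ?_, fun b c => ?_⟩
  · rcases h.1 t with h | h <;> simp [h]
  · dsimp only
    rw [h.2.1 x y, intervalIntegral.integral_neg]
    ring
  · simpa [eVariationOn, edist_neg_neg] using h.2.2 b c

theorem fRm_neg (A₀ : ℝ) (a : ℝ → ℝ) (R m : ℝ) (u g : ℝ → ℝ) :
    fRm A₀ a R m (fun t => -u t) (fun t => -g t) = fRm A₀ a R m u g := by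
  simp [fRm, eVariationOn, edist_neg_neg]

/-- The first point of the final stretch of `[b, t]` on which a continuous function stays above
a level: either `b` itself, or a point where the level is attained. -/
theorem exists_left_endpoint {u : ℝ → ℝ} (hu : Continuous u) {b t L : ℝ} (hbt : b ≤ t)
    (hL : L < u t) :
    ∃ p ∈ Set.Icc b t, (∀ x ∈ Set.Icc p t, L ≤ u x) ∧ (p = b ∨ u p = L) := by
  by_cases hne : ∃ x ∈ Set.Icc b t, u x ≤ L
  · have hK : IsCompact (Set.Icc b t ∩ {x | u x ≤ L}) :=
      isCompact_Icc.inter_right (isClosed_le hu continuous_const)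
    obtain ⟨p, ⟨hp, hpL⟩, hmax⟩ := hK.exists_isGreatest (by
      obtain ⟨x, hx, hxL⟩ := hne
      exact ⟨x, hx, hxL⟩)
    have heq : u p = L := by
      obtain ⟨y, hy, hyL⟩ := intermediate_value_Icc hp.2 hu.continuousOn ⟨hpL, hL.le⟩
      have := hmax ⟨⟨hp.1.trans hy.1, hy.2⟩, hyL.le⟩
      rw [← hyL, le_antisymm this hy.1]
    refine ⟨p, hp, fun x hx => ?_, Or.inr heq⟩
    by_contra! h
    have := hmax ⟨⟨hp.1.trans hx.1, hx.2⟩, h.le⟩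
    rw [le_antisymm this hx.1] at h
    linarith
  · push Not at hne
    exact ⟨b, ⟨le_rfl, hbt⟩, fun x hx => (hne x hx).le, Or.inl rfl⟩

theorem exists_right_endpoint {u : ℝ → ℝ} (hu : Continuous u) {b t L : ℝ} (htb : t ≤ b)
    (hL : L < u t) :
    ∃ q ∈ Set.Icc t b, (∀ x ∈ Set.Icc t q, L ≤ u x) ∧ (q = b ∨ u q = L) := by
  obtain ⟨p, hp, h, hpb⟩ := exists_left_endpoint (u := fun x => u (-x)) (b := -b) (t := -t)
    (L := L) (by fun_prop) (by linarith) (by simpa using hL)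
  refine ⟨-p, ⟨by linarith [hp.2], by linarith [hp.1]⟩, fun x hx => ?_, ?_⟩
  · simpa using h (-x) ⟨by linarith [hx.2], by linarith [hx.1]⟩
  · rcases hpb with h | h
    · exact Or.inl (by linarith)
    · exact Or.inr h

theorem integral_sub_left_endpoint (b s : ℝ) : ∫ t in b..b + s, (t - b) = s ^ 2 / 2 := by
  rw [intervalIntegral.integral_comp_sub_right (fun t => t), integral_id]
  ring

theorem integral_right_endpoint_sub (b s : ℝ) : ∫ t in b..b + s, (b + s - t) = s ^ 2 / 2 := by
  rw [intervalIntegral.integral_comp_sub_left (fun t => t), integral_id]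
  ring

/-- A sawtooth function can be replaced on `[p, p + 2 n s]` by `n` teeth of height `s` hanging
from the level `L`, without changing it where it attains the level at the endpoints. -/
theorem exists_teeth {u g : ℝ → ℝ} (hu : SawtoothLoc u g) {p q s L : ℝ} {n : ℕ} (hs : 0 < s)
    (hq : q = p + 2 * n * s) :
    ∃ v h, SawtoothLoc v h ∧
      (∀ S, eVariationOn h S ≤ eVariationOn g S + ENNReal.ofReal (4 * n + 2)) ∧
      (∀ t ∈ Set.Icc p q, L - s ≤ v t ∧ v t ≤ L) ∧
      ∫ t in p..q, (L - v t) = n * s ^ 2 ∧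
      (u p = L → ∀ t ≤ p, v t = u t) ∧ (u q = L → ∀ t, q ≤ t → v t = u t) := by
  set h := alternatingOn p s (2 * n : ℕ) g with hh
  have hvar : ∀ S, eVariationOn h S ≤ eVariationOn g S + ENNReal.ofReal (4 * n + 2) := by
    intro S
    refine (eVariationOn_alternatingOn_le hs (Int.natCast_nonneg _) hu.1 S).trans_eq ?_
    congr 2
    push_cast
    ring
  have hsaw := sawtoothLoc_primitive (alternatingOn_eq_one_or hu.1)
    (fun b c => (hvar (Set.Icc b c)).trans_lt
      (ENNReal.add_lt_top.2 ⟨hu.2.2 b c, ENNReal.ofReal_lt_top⟩)) p L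
  rw [← hh] at hsaw
  set v : ℝ → ℝ := fun t => L + ∫ x in p..t, h x with hv
  have hvp : v p = L := by simp [hv]
  have hdown : ∀ i < n, ∀ t ∈ Set.Icc (p + 2 * i * s) (p + 2 * i * s + s),
      v t = v (p + 2 * i * s) - (t - (p + 2 * i * s)) := by
    intro i hi t ht
    rw [hsaw.2.1 (p + 2 * i * s) t,
      intervalIntegral.integral_congr_Ioo_of_le (g := fun _ => -1) ht.1]
    · simp; ring
    · intro x hx
      rw [hh, alternatingOn_of_floor (j := 2 * i) hs (by omega) (by omega)
        (by push_cast; linarith [hx.1]) (by push_cast; linarith [hx.2, ht.2])]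
      simp
  have hup : ∀ i < n, ∀ t ∈ Set.Icc (p + 2 * i * s + s) (p + 2 * i * s + s + s),
      v t = v (p + 2 * i * s) - (p + 2 * i * s + s + s - t) := by
    intro i hi t ht
    rw [hsaw.2.1 (p + 2 * i * s + s) t,
      intervalIntegral.integral_congr_Ioo_of_le (g := fun _ => 1) ht.1,
      hdown i hi _ ⟨by linarith, le_rfl⟩]
    · simp; ring
    · intro x hx
      rw [hh, alternatingOn_of_floor (j := 2 * i + 1) hs (by omega) (by omega)
        (by push_cast; linarith [hx.1]) (by push_cast; linarith [hx.2, ht.2])]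
      simp
  have hnode : ∀ i ≤ n, v (p + 2 * i * s) = L := by
    intro i
    induction i with
    | zero => intro _; simpa using hvp
    | succ i ih =>
      intro hi
      have := hup i (by omega) (p + 2 * (i + 1 : ℕ) * s)
        ⟨by push_cast; linarith, by push_cast; linarith⟩
      rw [this, ih (by omega)]
      push_cast
      ring
  have hvq : v q = L := hq ▸ hnode n le_rfl
  refine ⟨v, h, hsaw, hvar, ?_, ?_, ?_, ?_⟩
  · intro t ht
    rcases eq_or_lt_of_le ht.2 with rfl | htq
    · rw [hvq]
      constructor <;> linarith
    have h0 : 0 ≤ (t - p) / (2 * s) := div_nonneg (by linarith [ht.1]) (by linarith)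
    have h1 := Nat.floor_le h0
    have h2 := Nat.lt_floor_add_one ((t - p) / (2 * s))
    have hi : ⌊(t - p) / (2 * s)⌋₊ < n := by
      rw [Nat.floor_lt h0, div_lt_iff₀ (by linarith)]
      linarith
    set i := ⌊(t - p) / (2 * s)⌋₊
    rw [le_div_iff₀ (by linarith)] at h1
    rw [div_lt_iff₀ (by linarith)] at h2
    have hL := hnode i hi.le
    rcases le_total t (p + 2 * i * s + s) with hc | hc
    · rw [hdown i hi t ⟨by linarith, hc⟩, hL]
      constructor <;> linarith
    · rw [hup i hi t ⟨hc, by linarith⟩, hL]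
      constructor <;> linarith
  · have hcont : Continuous fun t => L - v t := continuous_const.sub hsaw.continuous
    have hsum := intervalIntegral.sum_integral_adjacent_intervals (μ := volume)
      (f := fun t => L - v t) (a := fun i : ℕ => p + 2 * i * s) (n := n)
      fun k _ => hcont.intervalIntegrable _ _
    simp only [Nat.cast_zero, mul_zero, zero_mul, add_zero] at hsum
    rw [hq, ← hsum, Finset.sum_congr rfl (g := fun _ => s ^ 2)]
    · simp
    intro i hi
    rw [Finset.mem_range] at hi
    have hL := hnode i hi.le
    have hend : p + 2 * ((i + 1 : ℕ) : ℝ) * s = p + 2 * i * s + s + s := by push_cast; ring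
    rw [hend, ← intervalIntegral.integral_add_adjacent_intervals (b := p + 2 * i * s + s)
      (hcont.intervalIntegrable _ _) (hcont.intervalIntegrable _ _),
      intervalIntegral.integral_congr_Ioo_of_le (g := fun t => t - (p + 2 * i * s)) (by linarith),
      integral_sub_left_endpoint,
      intervalIntegral.integral_congr_Ioo_of_le
        (g := fun t => (p + 2 * i * s + s) + s - t) (by linarith),
      integral_right_endpoint_sub]
    · ring
    · intro t ht
      dsimp only
      rw [hup i hi t ⟨ht.1.le, ht.2.le⟩, hL]
      ring
    · intro t ht
      dsimp only
      rw [hdown i hi t ⟨ht.1.le, ht.2.le⟩, hL]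
      ring
  · intro hup t ht
    have h1 := hsaw.2.1 t p
    have h2 := hu.2.1 t p
    rw [intervalIntegral.integral_congr_Ioo_of_le (g := g) ht] at h1
    · linarith
    · exact fun x hx => alternatingOn_of_lt hs hx.2
  · intro huq t ht
    rw [hsaw.2.1 q t, hu.2.1 q t, hvq, huq,
      intervalIntegral.integral_congr_Ioo_of_le (g := g) ht]
    exact fun x hx => alternatingOn_of_ge hs (by push_cast; linarith [hx.1])

theorem le_of_fRm_le {A₀ R m C G : ℝ} {a u g v h : ℝ → ℝ} (hA₀ : 0 ≤ A₀) (hR : 0 < R)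
    (hm : 0 ≤ m) (hC : 0 ≤ C) (hG : 0 ≤ G)
    (hg : eVariationOn g (Set.Ioo (-(R / 2)) (R / 2)) ≠ ∞)
    (hv : ∫⁻ t in Set.Ioo (-(R / 2)) (R / 2), ENNReal.ofReal (a t * v t ^ 2) ≠ ∞)
    (hvar : eVariationOn h (Set.Ioo (-(R / 2)) (R / 2))
      ≤ eVariationOn g (Set.Ioo (-(R / 2)) (R / 2)) + ENNReal.ofReal C)
    (hint : (∫⁻ t in Set.Ioo (-(R / 2)) (R / 2), ENNReal.ofReal (a t * v t ^ 2))
      + ENNReal.ofReal G ≤ ∫⁻ t in Set.Ioo (-(R / 2)) (R / 2), ENNReal.ofReal (a t * u t ^ 2))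
    (hle : fRm A₀ a R m u g ≤ fRm A₀ a R m v h) : m * G ≤ A₀ * C := by
  unfold fRm at hle
  rw [ENNReal.mul_le_mul_iff_right (by simpa using hR) ENNReal.ofReal_ne_top] at hle
  set V := eVariationOn g (Set.Ioo (-(R / 2)) (R / 2))
  set I := ∫⁻ t in Set.Ioo (-(R / 2)) (R / 2), ENNReal.ofReal (a t * v t ^ 2)
  have key : ENNReal.ofReal A₀ * V + ENNReal.ofReal m * (I + ENNReal.ofReal G)
      ≤ ENNReal.ofReal A₀ * (V + ENNReal.ofReal C) + ENNReal.ofReal m * I := by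
    refine le_trans ?_ (hle.trans ?_) <;> gcongr
  rw [← ENNReal.ofReal_toReal hg, ← ENNReal.ofReal_toReal hv] at key
  have hV := ENNReal.toReal_nonneg (a := V)
  have hI := ENNReal.toReal_nonneg (a := I)
  rw [← ENNReal.ofReal_add hI hG, ← ENNReal.ofReal_add hV hC, ← ENNReal.ofReal_mul hA₀,
    ← ENNReal.ofReal_mul hm, ← ENNReal.ofReal_mul hA₀, ← ENNReal.ofReal_mul hm,
    ← ENNReal.ofReal_add (by positivity) (by positivity),
    ← ENNReal.ofReal_add (by positivity) (by positivity),
    ENNReal.ofReal_le_ofReal_iff (by positivity)] at key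
  linarith

theorem lintegral_mul_sq_ne_top {a v : ℝ → ℝ} (ha : ∀ t, a t ≤ 2) (hv : Continuous v) (b c : ℝ) :
    ∫⁻ t in Set.Ioo b c, ENNReal.ofReal (a t * v t ^ 2) ≠ ∞ := by
  have hi : IntegrableOn (fun t => 2 * v t ^ 2) (Set.Ioo b c) :=
    (Continuous.integrableOn_Icc (by fun_prop)).mono_set Set.Ioo_subset_Icc_self
  refine ((lintegral_mono fun t => ENNReal.ofReal_le_ofReal ?_).trans_lt
    hi.lintegral_lt_top).ne
  exact mul_le_mul_of_nonneg_right (ha t) (sq_nonneg _)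

/-- The energy gained when a sawtooth function staying above the level `L ≥ 0` on `[p, q]` is
replaced there by a function with values in `[0, L]`. -/
theorem lintegral_mul_sq_add_le {a u v : ℝ → ℝ} (hameas : Measurable a) (ha : ∀ t, 1 ≤ a t)
    (hv : Continuous v) {b c p q L : ℝ} (hbp : b ≤ p) (hpq : p ≤ q) (hqc : q ≤ c) (hL : 0 ≤ L)
    (hu : ∀ t ∈ Set.Icc p q, L ≤ u t) (hvL : ∀ t ∈ Set.Icc p q, 0 ≤ v t ∧ v t ≤ L)
    (hp : ∀ t ∈ Set.Ioo b c, t ≤ p → v t = u t) (hq : ∀ t ∈ Set.Ioo b c, q ≤ t → v t = u t) :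
    (∫⁻ t in Set.Ioo b c, ENNReal.ofReal (a t * v t ^ 2))
      + ENNReal.ofReal (L * ∫ t in p..q, (L - v t))
      ≤ ∫⁻ t in Set.Ioo b c, ENNReal.ofReal (a t * u t ^ 2) := by
  have hgain : ENNReal.ofReal (L * ∫ t in p..q, (L - v t))
      = ∫⁻ t in Set.Ioo b c, (Set.Ioo p q).indicator
          (fun t => ENNReal.ofReal (L * (L - v t))) t := by
    rw [lintegral_indicator measurableSet_Ioo, Measure.restrict_restrict measurableSet_Ioo,
      Set.inter_eq_self_of_subset_left (Set.Ioo_subset_Ioo hbp hqc),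
      ← ofReal_integral_eq_lintegral_ofReal, ← intervalIntegral.integral_const_mul,
      intervalIntegral.integral_of_le hpq, integral_Ioc_eq_integral_Ioo]
    · exact (Continuous.integrableOn_Icc (by fun_prop)).mono_set Set.Ioo_subset_Icc_self
    · filter_upwards [ae_restrict_mem measurableSet_Ioo] with t ht
      exact mul_nonneg hL (sub_nonneg.2 (hvL t (Set.Ioo_subset_Icc_self ht)).2)
  have hvm : Measurable fun t => ENNReal.ofReal (a t * v t ^ 2) :=
    (hameas.mul (hv.measurable.pow_const 2)).ennreal_ofReal
  rw [hgain, ← lintegral_add_left hvm]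
  refine setLIntegral_mono' measurableSet_Ioo fun t ht => ?_
  by_cases hmem : t ∈ Set.Ioo p q
  · obtain ⟨h0, h1⟩ := hvL t (Set.Ioo_subset_Icc_self hmem)
    have h2 := hu t (Set.Ioo_subset_Icc_self hmem)
    have h3 := ha t
    rw [Set.indicator_of_mem hmem, ← ENNReal.ofReal_add (by positivity)
      (mul_nonneg hL (sub_nonneg.2 h1))]
    refine ENNReal.ofReal_le_ofReal ?_
    have h4 : L * (L - v t) ≤ u t ^ 2 - v t ^ 2 := by nlinarith
    have h5 : 0 ≤ u t ^ 2 - v t ^ 2 := le_trans (mul_nonneg hL (sub_nonneg.2 h1)) h4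
    nlinarith
  · rw [Set.indicator_of_notMem hmem, add_zero]
    rcases le_or_gt t p with h | h
    · rw [hp t ht h]
    · rw [hq t ht (not_lt.1 fun h' => hmem ⟨h, h'⟩)]

/-- An interval of length `d ≥ 1` splits into an even number of pieces of length comparable
to `1`. -/
theorem exists_even_subdivision {d : ℝ} (hd : 1 ≤ d) :
    ∃ (n : ℕ) (s : ℝ), 1 ≤ n ∧ 1 / 4 ≤ s ∧ s ≤ 1 / 2 ∧ d = 2 * n * s := by
  have h1 := Nat.le_ceil d
  have h2 := Nat.ceil_lt_add_one (a := d) (by linarith)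
  have hn : (0 : ℝ) < ⌈d⌉₊ := by linarith
  refine ⟨⌈d⌉₊, d / (2 * ⌈d⌉₊), Nat.ceil_pos.2 (by linarith), ?_, ?_, ?_⟩
  · rw [le_div_iff₀ (by linarith)]
    linarith
  · rw [div_le_iff₀ (by linarith)]
    linarith
  · field_simp

/-- One-sided bound for minimizers. -/
theorem minimizer_le {α A₀ L R m : ℝ} (hα : 0 < α) (hA₀ : 0 < A₀) (hL : 1 ≤ L)
    (hLα : 96 * A₀ < α * L) {a : ℝ → ℝ} (hameas : Measurable a)
    (ha : ∀ t, 1 ≤ a t ∧ a t ≤ 2) (hR : 1 < R) (hαm : α ≤ m) {u g : ℝ → ℝ}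
    (hu : SawtoothLoc u g)
    (hmin : ∀ v h : ℝ → ℝ, SawtoothLoc v h → fRm A₀ a R m u g ≤ fRm A₀ a R m v h)
    {t : ℝ} (ht : t ∈ Set.Icc (-(R / 2)) (R / 2)) : u t ≤ L + 1 := by
  by_contra! hlt
  obtain ⟨p, hp, hpL, hp'⟩ := exists_left_endpoint hu.continuous (L := L) ht.1 (by linarith)
  obtain ⟨q, hq, hqL, hq'⟩ := exists_right_endpoint hu.continuous (L := L) ht.2 (by linarith)
  have huL : ∀ x ∈ Set.Icc p q, L ≤ u x := fun x hx =>
    (le_total x t).elim (fun h => hpL x ⟨hx.1, h⟩) fun h => hqL x ⟨h, hx.2⟩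
  have hlen : 1 ≤ q - p := by
    have h1 := (le_abs_self _).trans (hu.abs_sub_le p t)
    have h2 := (le_abs_self _).trans (hu.abs_sub_le q t)
    rw [abs_of_nonneg (sub_nonneg.2 hp.2)] at h1
    rw [abs_of_nonpos (sub_nonpos.2 hq.1)] at h2
    rcases hp' with hp' | hp' <;> rcases hq' with hq' | hq' <;> linarith [hp.2, hq.1]
  obtain ⟨n, s, hn, hs, hs', hd⟩ := exists_even_subdivision hlen
  have hn' : (1 : ℝ) ≤ n := by exact_mod_cast hn
  obtain ⟨v, h, hsaw, hvar, hvL, hvint, hvp, hvq⟩ :=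
    exists_teeth hu (p := p) (q := q) (s := s) (L := L) (n := n) (by linarith) (by linarith)
  have hgain := lintegral_mul_sq_add_le hameas (fun t => (ha t).1) hsaw.continuous hp.1
    (by linarith) hq.2 (by linarith) huL
    (fun t ht => ⟨by linarith [(hvL t ht).1], (hvL t ht).2⟩)
    (fun t ht htp => hp'.elim (fun h => by linarith [ht.1]) fun h => hvp h t htp)
    (fun t ht htq => hq'.elim (fun h => by linarith [ht.2]) fun h => hvq h t htq)
  rw [hvint] at hgain
  have key := le_of_fRm_le hA₀.le (by linarith) (by linarith : 0 ≤ m) (by positivity)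
    (by positivity)
    ((eVariationOn.mono g Set.Ioo_subset_Icc_self).trans_lt (hu.2.2 _ _)).ne
    (lintegral_mul_sq_ne_top (fun t => (ha t).2) hsaw.continuous _ _) (hvar _) hgain
    (hmin v h hsaw)
  have hs2 : 1 / 16 ≤ s ^ 2 := by nlinarith
  have h1 : α * L ≤ m * L := by gcongr
  have h2 : n * (m * L) * (1 / 16) ≤ n * (m * L) * s ^ 2 := by
    have : 0 ≤ m * L := le_trans (by positivity) h1
    gcongr
  have h3 : (n : ℝ) * (96 * A₀) < n * (m * L) :=
    mul_lt_mul_of_pos_left (by linarith) (by linarith)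
  have h4 : A₀ * 1 ≤ A₀ * n := by gcongr
  linarith

/-- Any minimizer of the sharp interface functional `f^ω_{R,m}` over sawtooth
functions, with `R > 1` and `α ≤ m ≤ β`, is uniformly bounded by a constant `M`
depending only on `α` and `β`. -/
theorem minimizer_uniformly_bounded
    (α β A₀ : ℝ) (hα : 0 < α) (hαβ : α ≤ β) (hA₀ : 0 < A₀) :
    ∃ M : ℝ, ∀ a : ℝ → ℝ, Measurable a → (∀ t, 1 ≤ a t ∧ a t ≤ 2) →
      ∀ R : ℝ, 1 < R → ∀ mval : ℝ, α ≤ mval → mval ≤ β →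
        ∀ u g : ℝ → ℝ, SawtoothLoc u g →
          (∀ v h : ℝ → ℝ, SawtoothLoc v h → fRm A₀ a R mval u g ≤ fRm A₀ a R mval v h) →
          ∀ t ∈ Set.Icc (-(R / 2)) (R / 2), |u t| ≤ M := by
  have hL : 1 ≤ 1 + 96 * A₀ / α := le_add_of_nonneg_right (by positivity)
  have hLα : 96 * A₀ < α * (1 + 96 * A₀ / α) := by
    have : α * (1 + 96 * A₀ / α) = α + 96 * A₀ := by field_simp
    linarith
  refine ⟨1 + 96 * A₀ / α + 1, fun a hameas ha R hR m hαm _ u g hu hmin t ht => abs_le'.2 ⟨?_, ?_⟩⟩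
  · exact minimizer_le hα hA₀ hL hLα hameas ha hR hαm hu hmin ht
  · refine minimizer_le hα hA₀ hL hLα hameas ha hR hαm hu.neg (fun v h hv => ?_) ht
    rw [fRm_neg]
    exact hmin v h hv
end
end
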